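/- arXiv:1212.3887 — 4 statements merged into one kernel-verified Lean document; each statement's English description precedes it below -/
import Mathlib

section
/- Let λ > 0 and define Φ_λ(x) = Γ(x+1)Γ(x+1/2+λ) / ((x+λ/2)·Γ(x+1/2)·Γ(x+λ)) and Ψ_λ(x) = (1 − Φ_λ(x) + Φ_λ(x)/(32x²))·x(x+λ) for real x > 0. Then for every real x with x ≥ 3λ³ and x ≥ 1/2, one has Ψ_λ(x+1) < Ψ_λ(x). Consequently, since β_λ(2n) = 4Ψ_λ(n) and β_λ(2n+1) = 4Ψ_λ(n+1/2), the sequences (β_λ(2n))_n and (β_λ(2n+1))_n are strictly decreasing for n ≥ 3λ³/2. -/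
open Real

/-- `α_{2n+1}^λ = (2 Γ(n+3/2) Γ(n+1+λ) / ((2n+λ+1) Γ(n+1) Γ(n+λ+1/2)))^{1/2}`, `n ≥ 0`. -/
noncomputable def alphaOdd (lam : ℝ) (n : ℕ) : ℝ :=
  Real.sqrt (2 * Real.Gamma ((n : ℝ) + 3 / 2) * Real.Gamma ((n : ℝ) + 1 + lam) /
    ((2 * (n : ℝ) + lam + 1) * Real.Gamma ((n : ℝ) + 1) * Real.Gamma ((n : ℝ) + lam + 1 / 2)))

/-- `α_{2n}^λ = (2 n! Γ(n+λ+1/2) / ((2n+λ) Γ(n+1/2) Γ(n+λ)))^{1/2}`, `n ≥ 1`. -/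
noncomputable def alphaEven (lam : ℝ) (n : ℕ) : ℝ :=
  Real.sqrt (2 * (n.factorial : ℝ) * Real.Gamma ((n : ℝ) + lam + 1 / 2) /
    ((2 * (n : ℝ) + lam) * Real.Gamma ((n : ℝ) + 1 / 2) * Real.Gamma ((n : ℝ) + lam)))

/-- `α_n^λ`, combining the two parities: `α_{2m}^λ = alphaEven λ m`, `α_{2m+1}^λ = alphaOdd λ m`. -/
noncomputable def alphaCoef (lam : ℝ) (n : ℕ) : ℝ :=
  if n % 2 = 1 then alphaOdd lam (n / 2) else alphaEven lam (n / 2)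

/-- `β_λ(n) = (1 - (α_n^λ)²(1 - 1/(8n²))) n (n+2λ)`. -/
noncomputable def betaCoef (lam : ℝ) (n : ℕ) : ℝ :=
  (1 - (alphaCoef lam n) ^ 2 * (1 - 1 / (8 * (n : ℝ) ^ 2))) * ((n : ℝ) * ((n : ℝ) + 2 * lam))

/-- `Φ_λ(x) = Γ(x+1) Γ(x+1/2+λ) / ((x+λ/2) Γ(x+1/2) Γ(x+λ))`. -/
noncomputable def phiFun (lam x : ℝ) : ℝ :=
  Real.Gamma (x + 1) * Real.Gamma (x + 1 / 2 + lam) /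
    ((x + lam / 2) * Real.Gamma (x + 1 / 2) * Real.Gamma (x + lam))

/-- `Ψ_λ(x) = (1 - Φ_λ(x) + Φ_λ(x)/(32x²)) x (x+λ)`. -/
noncomputable def psiFun (lam x : ℝ) : ℝ :=
  (1 - phiFun lam x + phiFun lam x / (32 * x ^ 2)) * (x * (x + lam))

lemma phiFun_pos {lam x : ℝ} (hlam : 0 < lam) (hx : 0 < x) : 0 < phiFun lam x := by
  unfold phiFun
  have h1 := Gamma_pos_of_pos (show 0 < x + 1 by linarith)
  have h2 := Gamma_pos_of_pos (show 0 < x + 1 / 2 + lam by linarith)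
  have h3 := Gamma_pos_of_pos (show 0 < x + 1 / 2 by linarith)
  have h4 := Gamma_pos_of_pos (show 0 < x + lam by linarith)
  positivity

lemma phiFun_add_one {lam x : ℝ} (hlam : 0 < lam) (hx : 0 < x) :
    phiFun lam (x + 1) * ((x + 1 + lam / 2) * (x + 1 / 2) * (x + lam)) =
      phiFun lam x * ((x + 1) * (x + 1 / 2 + lam) * (x + lam / 2)) := by
  unfold phiFun
  have h3 := Gamma_pos_of_pos (show 0 < x + 1 / 2 by linarith)
  have h4 := Gamma_pos_of_pos (show 0 < x + lam by linarith)
  rw [show x + 1 + 1 / 2 + lam = (x + 1 / 2 + lam) + 1 by ring,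
    show x + 1 + 1 / 2 = (x + 1 / 2) + 1 by ring, show x + 1 + lam = (x + lam) + 1 by ring,
    Gamma_add_one (s := x + 1) (by linarith), Gamma_add_one (s := x + 1 / 2 + lam) (by linarith),
    Gamma_add_one (s := x + 1 / 2) (by linarith), Gamma_add_one (s := x + lam) (by linarith)]
  have : x + 1 / 2 ≠ 0 := by linarith
  have : x + lam ≠ 0 := by linarith
  have : x + lam / 2 ≠ 0 := by linarith
  have : x + 1 + lam / 2 ≠ 0 := by linarith
  field_simp

/-- Log-convexity of `Γ` at the midpoint of `x` and `x + 1`. -/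
lemma Gamma_add_half_sq_le {x : ℝ} (hx : 0 < x) : Gamma (x + 1 / 2) ^ 2 ≤ x * Gamma x ^ 2 := by
  have h := Gamma_mul_add_mul_le_rpow_Gamma_mul_rpow_Gamma hx (show 0 < x + 1 by linarith)
    (show (0 : ℝ) < 1 / 2 by norm_num) (show (0 : ℝ) < 1 / 2 by norm_num) (by norm_num)
  have h0 := Gamma_pos_of_pos hx
  rw [show 1 / 2 * x + 1 / 2 * (x + 1) = x + 1 / 2 by ring, Gamma_add_one hx.ne',
    ← mul_rpow h0.le (by positivity), ← sqrt_eq_rpow] at h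
  have h1 := Gamma_pos_of_pos (show 0 < x + 1 / 2 by linarith)
  calc Gamma (x + 1 / 2) ^ 2 ≤ √(Gamma x * (x * Gamma x)) ^ 2 := by gcongr
    _ = x * Gamma x ^ 2 := by rw [sq_sqrt (by positivity)]; ring

lemma le_Gamma_add_half_sq {x : ℝ} (hx : 0 < x) :
    x * Gamma (x + 1 / 2) ^ 2 ≤ Gamma (x + 1) ^ 2 := by
  have h := Gamma_add_half_sq_le hx
  rw [Gamma_add_one hx.ne', mul_pow]
  nlinarith

lemma phiFun_sq_le {lam x : ℝ} (hlam : 0 < lam) (hx : 0 < x) :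
    phiFun lam x ^ 2 ≤ (x + 1 / 2) * (x + lam) / (x + lam / 2) ^ 2 := by
  have h3 := Gamma_pos_of_pos (show 0 < x + 1 / 2 by linarith)
  have h4 := Gamma_pos_of_pos (show 0 < x + lam by linarith)
  have h1 := Gamma_add_half_sq_le (show 0 < x + 1 / 2 by linarith)
  have h2 := Gamma_add_half_sq_le (show 0 < x + lam by linarith)
  rw [show x + 1 / 2 + 1 / 2 = x + 1 by ring] at h1
  rw [show x + lam + 1 / 2 = x + 1 / 2 + lam by ring] at h2
  unfold phiFun
  rw [div_pow, div_le_div_iff₀ (by positivity) (by positivity), mul_pow, mul_pow, mul_pow]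
  have := mul_le_mul h1 h2 (by positivity) (by positivity)
  nlinarith [mul_le_mul_of_nonneg_right this (sq_nonneg (x + lam / 2))]

lemma le_phiFun_sq {lam x : ℝ} (hlam : 0 < lam) (hx : 1 / 2 ≤ x) :
    x * (x + lam - 1 / 2) / (x + lam / 2) ^ 2 ≤ phiFun lam x ^ 2 := by
  have h3 := Gamma_pos_of_pos (show 0 < x + 1 / 2 by linarith)
  have h4 := Gamma_pos_of_pos (show 0 < x + lam by linarith)
  have h1 := le_Gamma_add_half_sq (show 0 < x by linarith)
  have h2 := le_Gamma_add_half_sq (show 0 < x + lam - 1 / 2 by linarith)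
  rw [show x + lam - 1 / 2 + 1 / 2 = x + lam by ring,
    show x + lam - 1 / 2 + 1 = x + 1 / 2 + lam by ring] at h2
  have h5 : 0 ≤ x + lam - 1 / 2 := by linarith
  have h6 : 0 < x := by linarith
  unfold phiFun
  rw [div_pow, div_le_div_iff₀ (by positivity) (by positivity), mul_pow, mul_pow, mul_pow]
  have := mul_le_mul h1 h2 (by positivity) (by positivity)
  nlinarith [mul_le_mul_of_nonneg_right this (sq_nonneg (x + lam / 2))]

lemma tendsto_quadratic_ratio (a b c : ℝ) :
    Filter.Tendsto (fun x : ℝ => (x + a) * (x + b) / (x + c) ^ 2) Filter.atTop (nhds 1) := by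
  have h (d : ℝ) : Filter.Tendsto (fun x : ℝ => 1 + d * x⁻¹) Filter.atTop (nhds 1) := by
    simpa using (tendsto_inv_atTop_zero.const_mul d).const_add 1
  have := ((h a).mul (h b)).div ((h c).pow 2) (by norm_num)
  simp only [mul_one, one_pow, div_one] at this
  refine this.congr' ?_
  filter_upwards [Filter.eventually_gt_atTop 0] with x hx
  simp only [Pi.div_apply]
  have e (d : ℝ) : 1 + d * x⁻¹ = (x + d) / x := by field_simp
  rw [e, e, e, div_pow, div_mul_div_comm, ← sq, div_div_div_cancel_right₀ (by positivity)]

lemma tendsto_phiFun {lam : ℝ} (hlam : 0 < lam) :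
    Filter.Tendsto (phiFun lam) Filter.atTop (nhds 1) := by
  have h : Filter.Tendsto (fun x => phiFun lam x ^ 2) Filter.atTop (nhds 1) := by
    refine tendsto_of_tendsto_of_tendsto_of_le_of_le'
      (tendsto_quadratic_ratio 0 (lam - 1 / 2) (lam / 2))
      (tendsto_quadratic_ratio (1 / 2) lam (lam / 2)) ?_ ?_
    · filter_upwards [Filter.eventually_ge_atTop (1 / 2)] with x hx
      simpa [add_sub_assoc] using le_phiFun_sq hlam hx
    · filter_upwards [Filter.eventually_gt_atTop 0] with x hx
      exact phiFun_sq_le hlam hx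
  have h2 := h.sqrt
  rw [sqrt_one] at h2
  refine h2.congr' ?_
  filter_upwards [Filter.eventually_gt_atTop 0] with x hx
  exact sqrt_sq (phiFun_pos hlam hx).le

/-- A rational lower approximant of `phiFun`, with a correction parameter `η`. -/
noncomputable def phiApprox (lam η x : ℝ) : ℝ :=
  ((x + lam / 2) ^ 2 + (lam * (1 - lam) * (3 / 16) + 1 / 8 - η)) /
    ((x + lam / 2) ^ 2 + (lam * (1 - lam) / 16 + 1 / 8 - η))

lemma phiApprox_num_pos {lam η x : ℝ} (hlam : 0 < lam) (hη : η ≤ 1 / 32) (hx : 0 < x) :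
    0 < (x + lam / 2) ^ 2 + (lam * (1 - lam) * (3 / 16) + 1 / 8 - η) := by
  nlinarith [mul_pos hlam hx, sq_nonneg lam, sq_nonneg x]

lemma phiApprox_den_pos {lam η x : ℝ} (hlam : 0 < lam) (hη : η ≤ 1 / 32) (hx : 0 < x) :
    0 < (x + lam / 2) ^ 2 + (lam * (1 - lam) / 16 + 1 / 8 - η) := by
  nlinarith [mul_pos hlam hx, sq_nonneg lam, sq_nonneg x]

lemma tendsto_phiApprox {lam : ℝ} (η : ℝ) :
    Filter.Tendsto (phiApprox lam η) Filter.atTop (nhds 1) := by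
  have h (d : ℝ) : Filter.Tendsto (fun x : ℝ => 1 + d * ((x + lam / 2) ^ 2)⁻¹)
      Filter.atTop (nhds 1) := by
    have h1 : Filter.Tendsto (fun x : ℝ => (x + lam / 2) ^ 2) Filter.atTop Filter.atTop :=
      (Filter.tendsto_pow_atTop two_ne_zero).comp
        (Filter.tendsto_atTop_add_const_right _ _ Filter.tendsto_id)
    simpa using ((tendsto_inv_atTop_zero.comp h1).const_mul d).const_add 1
  have := (h (lam * (1 - lam) * (3 / 16) + 1 / 8 - η)).div
    (h (lam * (1 - lam) / 16 + 1 / 8 - η)) one_ne_zero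
  rw [div_one] at this
  refine this.congr' ?_
  filter_upwards [Filter.eventually_gt_atTop (-(lam / 2))] with x hx
  have hx' : 0 < x + lam / 2 := by linarith
  have e (d : ℝ) : 1 + d * ((x + lam / 2) ^ 2)⁻¹ =
      ((x + lam / 2) ^ 2 + d) / (x + lam / 2) ^ 2 := by
    rw [add_div, div_self (by positivity), ← div_eq_mul_inv]
  simp only [Pi.div_apply, phiApprox]
  rw [e, e, div_div_div_cancel_right₀ (by positivity)]

lemma phiApprox_le_phiFun {lam η x : ℝ} (hlam : 0 < lam) (hη : η ≤ 1 / 32) (hx : 0 < x)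
    (hstep : ∀ z, x ≤ z → 0 ≤ lam * (1 - lam) *
      ((lam * (1 - lam) / 16 + 3 / 8 - η) * (lam * (1 - lam) * (3 / 16) + 3 / 8 - η) -
        2 * η * (z + lam / 2 + 1 / 2) ^ 2)) :
    phiApprox lam η x ≤ phiFun lam x := by
  set q : ℕ → ℝ := fun n => phiApprox lam η (x + n) / phiFun lam (x + n) with hq
  have hmono : Monotone q := by
    refine monotone_nat_of_le_succ fun n => ?_
    obtain ⟨z, hz⟩ : ∃ z, z = x + (n : ℝ) := ⟨_, rfl⟩
    have hxz : x ≤ z := by rw [hz]; linarith [n.cast_nonneg (α := ℝ)]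
    have hz0 : 0 < z := by linarith
    simp only [hq]
    push_cast
    rw [← add_assoc, ← hz, div_le_div_iff₀ (phiFun_pos hlam hz0) (phiFun_pos hlam (by linarith))]
    have h := phiFun_add_one hlam hz0
    have hden : 0 < (z + 1 + lam / 2) * (z + 1 / 2) * (z + lam) := by positivity
    rw [← eq_div_iff hden.ne'] at h
    have hp := phiFun_pos hlam hz0
    rw [h, mul_div_assoc, mul_left_comm, mul_comm (phiApprox _ _ _) (phiFun _ _)]
    refine mul_le_mul_of_nonneg_left ?_ hp.le
    have d0 := phiApprox_den_pos hlam hη hz0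
    have d1 := phiApprox_den_pos hlam hη (show 0 < z + 1 by linarith)
    unfold phiApprox
    rw [div_mul_div_comm, div_le_div_iff₀ (by positivity) d1]
    linear_combination (1 / 4) * hstep z hxz
  have hlim : Filter.Tendsto q Filter.atTop (nhds 1) := by
    have hn : Filter.Tendsto (fun n : ℕ => x + (n : ℝ)) Filter.atTop Filter.atTop :=
      Filter.tendsto_atTop_add_const_left _ _ tendsto_natCast_atTop_atTop
    have := ((tendsto_phiApprox (lam := lam) η).comp hn).div ((tendsto_phiFun hlam).comp hn)
      one_ne_zero
    rwa [div_one] at this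
  have h0 := hmono.ge_of_tendsto hlim 0
  simp only [hq, Nat.cast_zero, add_zero] at h0
  rwa [div_le_one (phiFun_pos hlam hx)] at h0

lemma psiFun_add_one_lt_of_lt {lam x : ℝ} (hlam : 0 < lam) (hx : 0 < x)
    (h : (2 * x + 1 + lam) * (32 * x) * ((x + 1) * (x + 1 / 2 + lam) * (x + lam / 2)) <
      phiFun lam (x + 1) *
        (x * (x + 1 + lam) * (32 * (x + 1) ^ 2 - 1) * (x + 1 / 2 + lam) * (x + lam / 2) -
          (x + lam) ^ 2 * (32 * x ^ 2 - 1) * (x + 1 + lam / 2) * (x + 1 / 2))) :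
    psiFun lam (x + 1) < psiFun lam x := by
  have hnum : 0 < (x + 1) * (x + 1 / 2 + lam) * (x + lam / 2) := by positivity
  have hs := phiFun_add_one hlam hx
  rw [eq_comm, ← eq_div_iff hnum.ne'] at hs
  rw [← sub_pos]
  have key : psiFun lam x - psiFun lam (x + 1) =
      (phiFun lam (x + 1) *
        (x * (x + 1 + lam) * (32 * (x + 1) ^ 2 - 1) * (x + 1 / 2 + lam) * (x + lam / 2) -
          (x + lam) ^ 2 * (32 * x ^ 2 - 1) * (x + 1 + lam / 2) * (x + 1 / 2)) -
      (2 * x + 1 + lam) * (32 * x) * ((x + 1) * (x + 1 / 2 + lam) * (x + lam / 2))) /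
      (32 * x * ((x + 1) * (x + 1 / 2 + lam) * (x + lam / 2))) := by
    unfold psiFun
    rw [hs]
    have : x + 1 / 2 + lam ≠ 0 := by positivity
    have : x + lam / 2 ≠ 0 := by positivity
    field_simp
    ring
  rw [key]
  exact div_pos (by linarith) (by positivity)

lemma psiFun_add_one_lt_of_phiApprox_le {lam η x : ℝ} (hlam : 0 < lam) (hη : η ≤ 1 / 32)
    (hx : 0 < x) (hle : phiApprox lam η (x + 1) ≤ phiFun lam (x + 1))
    (h : (2 * x + 1 + lam) * (32 * x) * ((x + 1) * (x + 1 / 2 + lam) * (x + lam / 2)) *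
        ((x + 1 + lam / 2) ^ 2 + (lam * (1 - lam) / 16 + 1 / 8 - η)) <
      ((x + 1 + lam / 2) ^ 2 + (lam * (1 - lam) * (3 / 16) + 1 / 8 - η)) *
        (x * (x + 1 + lam) * (32 * (x + 1) ^ 2 - 1) * (x + 1 / 2 + lam) * (x + lam / 2) -
          (x + lam) ^ 2 * (32 * x ^ 2 - 1) * (x + 1 + lam / 2) * (x + 1 / 2))) :
    psiFun lam (x + 1) < psiFun lam x := by
  refine psiFun_add_one_lt_of_lt hlam hx ?_
  have hN := phiApprox_num_pos hlam hη (show 0 < x + 1 by linarith)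
  have hD := phiApprox_den_pos hlam hη (show 0 < x + 1 by linarith)
  have hR := pos_of_mul_pos_right ((mul_pos (by positivity) hD).trans h) hN.le
  refine lt_of_lt_of_le ?_ (mul_le_mul_of_nonneg_right hle hR.le)
  rw [phiApprox, div_mul_eq_mul_div, lt_div_iff₀ hD]
  exact h

lemma psiFun_add_one_lt_of_le_one {lam x : ℝ} (hlam : 0 < lam) (h1 : lam ≤ 1)
    (hx : 1 / 2 ≤ x) : psiFun lam (x + 1) < psiFun lam x := by
  have hm : 0 ≤ 1 - lam := by linarith
  refine psiFun_add_one_lt_of_phiApprox_le (η := 0) hlam (by norm_num) (by linarith)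
    (phiApprox_le_phiFun hlam (by norm_num) (by linarith) fun z _ => ?_) ?_
  · simp only [mul_zero, zero_mul, sub_zero]
    positivity
  obtain ⟨y, rfl⟩ : ∃ y, x = y + 1 / 2 := ⟨x - 1 / 2, by ring⟩
  have hy : 0 ≤ y := by linarith
  obtain ⟨m, hmdef⟩ : ∃ m, m = 1 - lam := ⟨_, rfl⟩
  rw [← hmdef] at hm
  have hpos : 0 <
      (135 / 64 * lam + 533 / 128 * lam ^ 2 + 253 / 128 * lam ^ 3 + 89 / 128 * lam ^ 3 * m +
        87 / 64 * lam ^ 3 * m * (1 + lam)) +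
      y * (281 / 32 * lam + 675 / 64 * lam ^ 2 + 67 / 64 * lam ^ 3 + 243 / 64 * lam ^ 3 * m +
        7 / 2 * lam ^ 3 * m * (1 + lam)) +
      y ^ 2 * (47 / 4 * lam + 51 / 8 * lam ^ 2 + 19 / 16 * lam ^ 2 * m + 17 / 4 * lam ^ 3 * m +
        3 / 2 * lam ^ 3 * m * (1 + lam)) +
      y ^ 3 * (23 / 4 * lam + 5 / 4 * lam ^ 2 + 1 / 2 * lam ^ 2 * m + 3 / 2 * lam ^ 3 * m) +
      y ^ 4 * lam := by positivity
  subst hmdef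
  linear_combination hpos

lemma psiFun_add_one_lt_of_one_le {lam x : ℝ} (h1 : 1 ≤ lam)
    (hx : 3 * lam ^ 3 / 2 ≤ x) : psiFun lam (x + 1) < psiFun lam x := by
  obtain ⟨m, rfl⟩ : ∃ m, lam = m + 1 := ⟨lam - 1, by ring⟩
  have hm : 0 ≤ m := by linarith
  have hx0 : 0 < x := lt_of_lt_of_le (by positivity) hx
  refine psiFun_add_one_lt_of_phiApprox_le (η := 1 / 32) (by linarith) le_rfl hx0
    (phiApprox_le_phiFun (by linarith) le_rfl (by linarith) fun z hz => ?_) ?_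
  · obtain ⟨y, rfl⟩ : ∃ y, z = 3 * (m + 1) ^ 3 / 2 + y := ⟨z - 3 * (m + 1) ^ 3 / 2, by ring⟩
    have hy : 0 ≤ y := by linarith
    refine mul_nonneg_of_nonpos_of_nonpos (by nlinarith) ?_
    rw [← neg_nonneg]
    ring_nf
    positivity
  · obtain ⟨y, rfl⟩ : ∃ y, x = 3 * (m + 1) ^ 3 / 2 + y := ⟨x - 3 * (m + 1) ^ 3 / 2, by ring⟩
    have hy : 0 ≤ y := by linarith
    rw [← sub_pos]
    ring_nf
    positivity

theorem psiFun_add_one_lt {lam x : ℝ} (hlam : 0 < lam) (h : 3 * lam ^ 3 / 2 ≤ x)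
    (hx : 1 / 2 ≤ x) : psiFun lam (x + 1) < psiFun lam x := by
  rcases le_total lam 1 with h1 | h1
  · exact psiFun_add_one_lt_of_le_one hlam h1 hx
  · exact psiFun_add_one_lt_of_one_le h1 h

lemma betaCoef_even {lam : ℝ} (hlam : 0 < lam) {n : ℕ} (hn : 1 ≤ n) :
    betaCoef lam (2 * n) = 4 * psiFun lam n := by
  have hn0 : (0 : ℝ) < n := by exact_mod_cast hn
  have h : alphaCoef lam (2 * n) ^ 2 = phiFun lam n := by
    have hp := phiFun_pos hlam hn0
    have e : 2 * (n.factorial : ℝ) * Gamma ((n : ℝ) + lam + 1 / 2) /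
        ((2 * (n : ℝ) + lam) * Gamma ((n : ℝ) + 1 / 2) * Gamma ((n : ℝ) + lam)) =
        phiFun lam n := by
      unfold phiFun
      rw [Gamma_nat_eq_factorial, show (n : ℝ) + 1 / 2 + lam = n + lam + 1 / 2 by ring,
        show 2 * (n : ℝ) + lam = 2 * (n + lam / 2) by ring, mul_assoc, mul_assoc 2, mul_assoc 2,
        mul_div_mul_left _ _ two_ne_zero, mul_assoc]
    simp only [alphaCoef, alphaEven, Nat.mul_mod_right, Nat.zero_ne_one, if_false,
      Nat.mul_div_cancel_left n two_pos]
    rw [e, sq_sqrt hp.le]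
  unfold betaCoef psiFun
  rw [h]
  push_cast
  field_simp
  ring

lemma betaCoef_odd {lam : ℝ} (hlam : 0 < lam) (n : ℕ) :
    betaCoef lam (2 * n + 1) = 4 * psiFun lam (n + 1 / 2) := by
  have hn0 : (0 : ℝ) ≤ n := n.cast_nonneg
  have h : alphaCoef lam (2 * n + 1) ^ 2 = phiFun lam (n + 1 / 2) := by
    have hp := phiFun_pos hlam (show 0 < (n : ℝ) + 1 / 2 by positivity)
    have e : 2 * Gamma ((n : ℝ) + 3 / 2) * Gamma ((n : ℝ) + 1 + lam) /
        ((2 * (n : ℝ) + lam + 1) * Gamma ((n : ℝ) + 1) * Gamma ((n : ℝ) + lam + 1 / 2)) =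
        phiFun lam (n + 1 / 2) := by
      unfold phiFun
      rw [show (n : ℝ) + 1 / 2 + 1 = n + 3 / 2 by ring,
        show (n : ℝ) + 1 / 2 + 1 / 2 = n + 1 by ring,
        show (n : ℝ) + 1 / 2 + lam = n + lam + 1 / 2 by ring,
        show 2 * (n : ℝ) + lam + 1 = 2 * (n + 1 / 2 + lam / 2) by ring, mul_assoc, mul_assoc 2,
        mul_assoc 2, mul_div_mul_left _ _ two_ne_zero, mul_assoc]
    simp only [alphaCoef, alphaOdd]
    rw [if_pos (by omega), show (2 * n + 1) / 2 = n by omega, e, sq_sqrt hp.le]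
  unfold betaCoef psiFun
  rw [h]
  push_cast
  have : (n : ℝ) + 1 / 2 ≠ 0 := by positivity
  have : 2 * (n : ℝ) + 1 ≠ 0 := by positivity
  field_simp
  ring

/-- **Proposition 5.1.** For `λ > 0` and real `x ≥ max(3λ³, 1/2)`, `Ψ_λ(x+1) < Ψ_λ(x)`.
Consequently, since `β_λ(2n) = 4Ψ_λ(n)` and `β_λ(2n+1) = 4Ψ_λ(n+1/2)`, the sequences
`(β_λ(2n))_n` and `(β_λ(2n+1))_n` are strictly decreasing for `n ≥ 3λ³/2`. -/
theorem psi_strict_anti (lam : ℝ) (hlam : 0 < lam) :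
    (∀ x : ℝ, 3 * lam ^ 3 ≤ x → 1 / 2 ≤ x → psiFun lam (x + 1) < psiFun lam x) ∧
    (∀ n : ℕ, 3 * lam ^ 3 / 2 ≤ (n : ℝ) → 1 ≤ n →
      betaCoef lam (2 * (n + 1)) < betaCoef lam (2 * n) ∧
      betaCoef lam (2 * (n + 1) + 1) < betaCoef lam (2 * n + 1)) := by
  refine ⟨fun x h hx => psiFun_add_one_lt hlam (by linarith [pow_pos hlam 3]) hx,
    fun n h hn => ?_⟩
  have hn1 : (1 : ℝ) ≤ n := by exact_mod_cast hn
  rw [betaCoef_even hlam hn, betaCoef_even hlam (by omega), betaCoef_odd hlam, betaCoef_odd hlam]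
  push_cast
  have h2 := psiFun_add_one_lt (x := n + 1 / 2) hlam (by linarith) (by linarith)
  rw [add_right_comm] at h2
  exact ⟨by linarith [psiFun_add_one_lt hlam h (by linarith)], by linarith⟩
end

section
/- With β_λ(n) as defined: (a) β_{1/2}(n) ≥ 0 for all n ≥ 1; (b) β_1(n) ≥ 1/8 for all n ≥ 1; (c) β_{3/2}(n) ≥ 1/2 for all n ≥ 1; (d) β_2(n) ≥ 9/8 for all n ≥ 4, while β_2(3) < 9/8; moreover β_2(2) = 141/128 and min_{n≥1} β_2(n) = 141/128. (Here (2λ−1)²/8 equals 0, 1/8, 1/2, 9/8 for λ = 1/2, 1, 3/2, 2 respectively.) -/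
open Real

/-- The two parities in the definition of `α_k^λ` are given by a single formula in `k / 2`. -/
lemma alphaCoef_sq {lam : ℝ} (hlam : 0 < lam) (k : ℕ) :
    alphaCoef lam k ^ 2 = 2 * Gamma ((k : ℝ) / 2 + 1) * Gamma ((k : ℝ) / 2 + lam + 1 / 2) /
      (((k : ℝ) + lam) * Gamma ((k : ℝ) / 2 + 1 / 2) * Gamma ((k : ℝ) / 2 + lam)) := by
  unfold alphaCoef
  split_ifs with h
  · obtain ⟨n, rfl⟩ : ∃ n, k = 2 * n + 1 := ⟨k / 2, by omega⟩
    have hn : (2 * n + 1) / 2 = n := by omega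
    have e₁ : ((2 * n + 1 : ℕ) : ℝ) / 2 + 1 = n + 3 / 2 := by push_cast; ring
    have e₂ : ((2 * n + 1 : ℕ) : ℝ) / 2 + lam + 1 / 2 = n + 1 + lam := by push_cast; ring
    have e₃ : ((2 * n + 1 : ℕ) : ℝ) / 2 + 1 / 2 = n + 1 := by push_cast; ring
    have e₄ : ((2 * n + 1 : ℕ) : ℝ) / 2 + lam = n + lam + 1 / 2 := by push_cast; ring
    have e₅ : ((2 * n + 1 : ℕ) : ℝ) + lam = 2 * n + lam + 1 := by push_cast; ring
    have p₁ : 0 < Gamma ((n : ℝ) + 3 / 2) := Gamma_pos_of_pos (by positivity)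
    have p₂ : 0 < Gamma ((n : ℝ) + 1 + lam) := Gamma_pos_of_pos (by positivity)
    have p₃ : 0 < Gamma ((n : ℝ) + 1) := Gamma_pos_of_pos (by positivity)
    have p₄ : 0 < Gamma ((n : ℝ) + lam + 1 / 2) := Gamma_pos_of_pos (by positivity)
    rw [hn, e₁, e₂, e₃, e₄, e₅, alphaOdd, sq_sqrt (by positivity)]
  · obtain ⟨n, rfl⟩ : ∃ n, k = 2 * n := ⟨k / 2, by omega⟩
    have hn : 2 * n / 2 = n := by omega
    have e : ((2 * n : ℕ) : ℝ) / 2 = n := by push_cast; ring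
    have p₁ : 0 < Gamma ((n : ℝ) + lam + 1 / 2) := Gamma_pos_of_pos (by positivity)
    have p₂ : 0 < Gamma ((n : ℝ) + 1 / 2) := Gamma_pos_of_pos (by positivity)
    have p₃ : 0 < Gamma ((n : ℝ) + lam) := Gamma_pos_of_pos (by positivity)
    rw [hn, e, alphaEven, sq_sqrt (by positivity), Gamma_nat_eq_factorial]
    push_cast
    rfl

/-- The squared ratio `(Γ(x+1) / Γ(x+1/2))²`. -/
noncomputable def gammaRatioSq (x : ℝ) : ℝ := (Gamma (x + 1) / Gamma (x + 1 / 2)) ^ 2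

lemma gammaRatioSq_add_one {x : ℝ} (hx : 0 < x) :
    gammaRatioSq (x + 1) = gammaRatioSq x * ((x + 1) / (x + 1 / 2)) ^ 2 := by
  have h : Gamma (x + 1 + 1 / 2) = (x + 1 / 2) * Gamma (x + 1 / 2) := by
    rw [← Gamma_add_one (by positivity)]; ring_nf
  rw [gammaRatioSq, gammaRatioSq, h, Gamma_add_one (s := x + 1) (by positivity), ← mul_pow]
  congr 1
  have := (Gamma_pos_of_pos (by positivity : 0 < x + 1 / 2)).ne'
  field_simp

/-- The crude bound coming from log-convexity of the Gamma function. -/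
lemma gammaRatioSq_le_add_half {x : ℝ} (hx : 0 < x) : gammaRatioSq x ≤ x + 1 / 2 := by
  have hG : 0 < Gamma (x + 1 / 2) := Gamma_pos_of_pos (by positivity)
  have h := Gamma_mul_add_mul_le_rpow_Gamma_mul_rpow_Gamma (s := x + 1 / 2) (t := x + 1 / 2 + 1)
    (a := 1 / 2) (b := 1 / 2) (by positivity) (by positivity) (by norm_num) (by norm_num)
    (by norm_num)
  have hG' : 0 < Gamma (x + 1 / 2 + 1) := Gamma_pos_of_pos (by positivity)
  have e : 1 / 2 * (x + 1 / 2) + 1 / 2 * (x + 1 / 2 + 1) = x + 1 := by ring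
  rw [e, ← sqrt_eq_rpow, ← sqrt_eq_rpow, ← sqrt_mul hG.le,
    le_sqrt (Gamma_pos_of_pos (by positivity)).le (by positivity),
    Gamma_add_one (s := x + 1 / 2) (by positivity)] at h
  rw [gammaRatioSq, div_pow, div_le_iff₀ (by positivity)]
  linarith

/-- The upper bound by the first three terms of the asymptotic expansion. -/
lemma gammaRatioSq_le {x : ℝ} (hx : 1 / 2 ≤ x) :
    gammaRatioSq x ≤ x + 1 / 4 + 1 / (32 * x) := by
  set V : ℝ → ℝ := fun y ↦ y + 1 / 4 + 1 / (32 * y) with hV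
  have hVpos : ∀ y, 0 < y → 0 < V y := fun y hy ↦ by simp only [hV]; positivity
  have hstep : ∀ y, 1 / 2 ≤ y → V (y + 1) ≤ V y * ((y + 1) / (y + 1 / 2)) ^ 2 := fun y hy ↦ by
    have h0 : 0 < y := by linarith
    have key : V y * ((y + 1) / (y + 1 / 2)) ^ 2 - V (y + 1) =
        (3 * y / 4 + 1) / (32 * y * (y + 1) * (y + 1 / 2) ^ 2) := by
      simp only [hV]; field_simp; ring
    have : 0 ≤ (3 * y / 4 + 1) / (32 * y * (y + 1) * (y + 1 / 2) ^ 2) := by positivity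
    linarith
  by_contra! hlt
  have hx0 : 0 < x := by linarith
  obtain ⟨c, hc⟩ : ∃ c, c = gammaRatioSq x / V x := ⟨_, rfl⟩
  have hc1 : 1 < c := by rw [hc, one_lt_div (hVpos x hx0)]; exact hlt
  have hgrow : ∀ m : ℕ, c * V (x + m) ≤ gammaRatioSq (x + m) := by
    intro m
    induction m with
    | zero => simp [hc, div_mul_cancel₀ _ (hVpos x hx0).ne']
    | succ m ih =>
      have hm : 1 / 2 ≤ x + m := by linarith [m.cast_nonneg (α := ℝ)]
      have e : x + ((m + 1 : ℕ) : ℝ) = x + m + 1 := by push_cast; ring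
      rw [e, gammaRatioSq_add_one (by positivity)]
      calc c * V (x + m + 1) ≤ c * (V (x + m) * ((x + m + 1) / (x + m + 1 / 2)) ^ 2) := by
            gcongr; exact hstep _ hm
        _ = c * V (x + m) * ((x + m + 1) / (x + m + 1 / 2)) ^ 2 := by ring
        _ ≤ _ := by gcongr
  obtain ⟨m, hm⟩ := exists_nat_gt (1 / (c - 1))
  rw [div_lt_iff₀ (by linarith)] at hm
  have h₁ := hgrow m
  have h₂ := gammaRatioSq_le_add_half (x := x + m) (by positivity)
  have h₃ : c * (x + m) ≤ c * V (x + m) := by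
    have : 0 ≤ 1 / (32 * (x + m)) := by positivity
    gcongr
    simp only [hV]
    linarith
  nlinarith [mul_pos (sub_pos.2 hc1) hx0]

lemma alphaCoef_half_sq (k : ℕ) :
    alphaCoef (1 / 2) k ^ 2 = 2 * gammaRatioSq (k / 2) / (k + 1 / 2) := by
  rw [alphaCoef_sq (by norm_num), gammaRatioSq,
    show (k : ℝ) / 2 + 1 / 2 + 1 / 2 = k / 2 + 1 by ring]
  have := (Gamma_pos_of_pos (by positivity : 0 < (k : ℝ) / 2 + 1 / 2)).ne'
  field_simp

lemma alphaCoef_three_halves_sq (k : ℕ) :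
    alphaCoef (3 / 2) k ^ 2 =
      2 * gammaRatioSq (k / 2) * (k + 2) / ((k + 3 / 2) * (k + 1)) := by
  have e₁ : Gamma ((k : ℝ) / 2 + 3 / 2 + 1 / 2) = (k / 2 + 1) * Gamma (k / 2 + 1) := by
    rw [← Gamma_add_one (by positivity)]; ring_nf
  have e₂ : Gamma ((k : ℝ) / 2 + 3 / 2) = (k / 2 + 1 / 2) * Gamma (k / 2 + 1 / 2) := by
    rw [← Gamma_add_one (by positivity)]; ring_nf
  rw [alphaCoef_sq (by norm_num), gammaRatioSq, e₁, e₂]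
  have := (Gamma_pos_of_pos (by positivity : 0 < (k : ℝ) / 2 + 1 / 2)).ne'
  field_simp

lemma alphaCoef_one_sq (k : ℕ) : alphaCoef 1 k ^ 2 = 1 := by
  have e : Gamma ((k : ℝ) / 2 + 1 + 1 / 2) = (k / 2 + 1 / 2) * Gamma (k / 2 + 1 / 2) := by
    rw [← Gamma_add_one (by positivity)]; ring_nf
  rw [alphaCoef_sq (by norm_num), e]
  have := (Gamma_pos_of_pos (by positivity : 0 < (k : ℝ) / 2 + 1 / 2)).ne'
  have := (Gamma_pos_of_pos (by positivity : 0 < (k : ℝ) / 2 + 1)).ne'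
  field_simp

lemma alphaCoef_two_sq (k : ℕ) :
    alphaCoef 2 k ^ 2 = ((k : ℝ) + 3) * (k + 1) / (k + 2) ^ 2 := by
  have e₁ : Gamma ((k : ℝ) / 2 + 2 + 1 / 2) =
      (k / 2 + 3 / 2) * ((k / 2 + 1 / 2) * Gamma (k / 2 + 1 / 2)) := by
    rw [← Gamma_add_one (by positivity),
      show (k : ℝ) / 2 + 1 / 2 + 1 = k / 2 + 3 / 2 by ring, ← Gamma_add_one (by positivity)]
    ring_nf
  have e₂ : Gamma ((k : ℝ) / 2 + 2) = (k / 2 + 1) * Gamma (k / 2 + 1) := by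
    rw [← Gamma_add_one (by positivity)]; ring_nf
  rw [alphaCoef_sq (by norm_num), e₁, e₂]
  have := (Gamma_pos_of_pos (by positivity : 0 < (k : ℝ) / 2 + 1 / 2)).ne'
  have := (Gamma_pos_of_pos (by positivity : 0 < (k : ℝ) / 2 + 1)).ne'
  field_simp

lemma one_sub_inv_eight_sq_nonneg {k : ℝ} (hk : 1 ≤ k) : 0 ≤ 1 - 1 / (8 * k ^ 2) := by
  rw [sub_nonneg, div_le_one (by positivity)]
  nlinarith

lemma gammaRatioSq_half_le {k : ℝ} (hk : 1 ≤ k) :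
    gammaRatioSq (k / 2) ≤ k / 2 + 1 / 4 + 1 / (16 * k) := by
  have h := gammaRatioSq_le (x := k / 2) (by linarith)
  rwa [show 32 * (k / 2) = 16 * k by ring] at h

lemma betaCoef_half_nonneg {n : ℕ} (hn : 1 ≤ n) : 0 ≤ betaCoef (1 / 2) n := by
  have hk : (1 : ℝ) ≤ n := by exact_mod_cast hn
  rw [betaCoef, alphaCoef_half_sq]
  generalize (n : ℝ) = k at hk ⊢
  have hk0 : 0 < k := by linarith
  apply mul_nonneg _ (by positivity)
  have h : 2 * gammaRatioSq (k / 2) / (k + 1 / 2) * (1 - 1 / (8 * k ^ 2)) ≤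
      2 * (k / 2 + 1 / 4 + 1 / (16 * k)) / (k + 1 / 2) * (1 - 1 / (8 * k ^ 2)) := by
    have := one_sub_inv_eight_sq_nonneg hk
    have := gammaRatioSq_half_le hk
    gcongr
  have key : 1 - 2 * (k / 2 + 1 / 4 + 1 / (16 * k)) / (k + 1 / 2) * (1 - 1 / (8 * k ^ 2)) =
      (4 * k + 1) / (64 * k ^ 3 * (k + 1 / 2)) := by
    field_simp
    ring
  have : 0 ≤ (4 * k + 1) / (64 * k ^ 3 * (k + 1 / 2)) := by positivity
  linarith

lemma betaCoef_one_ge {n : ℕ} (hn : 1 ≤ n) : 1 / 8 ≤ betaCoef 1 n := by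
  have hk : (0 : ℝ) < n := by exact_mod_cast hn
  have key : betaCoef 1 n = 1 / 8 + 1 / (4 * n) := by
    rw [betaCoef, alphaCoef_one_sq]
    field_simp
    ring
  rw [key]
  linarith [show (0 : ℝ) < 1 / (4 * n) by positivity]

lemma betaCoef_three_halves_ge {n : ℕ} (hn : 1 ≤ n) : 1 / 2 ≤ betaCoef (3 / 2) n := by
  have hk : (1 : ℝ) ≤ n := by exact_mod_cast hn
  rw [betaCoef, alphaCoef_three_halves_sq]
  generalize (n : ℝ) = k at hk ⊢
  have hk0 : 0 < k := by linarith
  have h : 2 * gammaRatioSq (k / 2) * (k + 2) / ((k + 3 / 2) * (k + 1)) * (1 - 1 / (8 * k ^ 2)) ≤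
      2 * (k / 2 + 1 / 4 + 1 / (16 * k)) * (k + 2) / ((k + 3 / 2) * (k + 1)) *
        (1 - 1 / (8 * k ^ 2)) := by
    have := one_sub_inv_eight_sq_nonneg hk
    have := gammaRatioSq_half_le hk
    gcongr
  have hmul := mul_le_mul_of_nonneg_right (sub_le_sub_left h 1)
    (show 0 ≤ k * (k + 2 * (3 / 2)) by positivity)
  refine le_trans ?_ hmul
  obtain ⟨t, rfl⟩ : ∃ t, k = 1 + t := ⟨k - 1, by ring⟩
  have ht : 0 ≤ t := by linarith
  rw [← sub_nonneg]
  field_simp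
  ring_nf
  positivity

lemma betaCoef_two_eq {n : ℕ} (hn : 1 ≤ n) :
    betaCoef 2 n = 9 / 8 + (4 * (n : ℝ) ^ 2 - 17 * n + 12) / (8 * n * (n + 2) ^ 2) := by
  have hk : (0 : ℝ) < n := by exact_mod_cast hn
  rw [betaCoef, alphaCoef_two_sq]
  field_simp
  ring

lemma betaCoef_two_ge {n : ℕ} (hn : 4 ≤ n) : 9 / 8 ≤ betaCoef 2 n := by
  have hk : (4 : ℝ) ≤ n := by exact_mod_cast hn
  rw [betaCoef_two_eq (by omega), le_add_iff_nonneg_right]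
  exact div_nonneg (by nlinarith) (by positivity)

lemma betaCoef_two_two : betaCoef 2 2 = 141 / 128 := by
  rw [betaCoef_two_eq (by norm_num)]
  norm_num

/-- **Lemma 3.5 (v), numerical facts.** (a) `β_{1/2}(n) ≥ 0` for `n ≥ 1`;
(b) `β_1(n) ≥ 1/8` for `n ≥ 1`; (c) `β_{3/2}(n) ≥ 1/2` for `n ≥ 1`;
(d) `β_2(n) ≥ 9/8` for `n ≥ 4`, while `β_2(3) < 9/8`; moreover `β_2(2) = 141/128`
and `min_{n ≥ 1} β_2(n) = 141/128`. -/
theorem beta_numerical_facts :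
    (∀ n : ℕ, 1 ≤ n → 0 ≤ betaCoef (1 / 2) n) ∧
    (∀ n : ℕ, 1 ≤ n → 1 / 8 ≤ betaCoef 1 n) ∧
    (∀ n : ℕ, 1 ≤ n → 1 / 2 ≤ betaCoef (3 / 2) n) ∧
    (∀ n : ℕ, 4 ≤ n → 9 / 8 ≤ betaCoef 2 n) ∧
    betaCoef 2 3 < 9 / 8 ∧
    betaCoef 2 2 = 141 / 128 ∧
    IsLeast {y : ℝ | ∃ n : ℕ, 1 ≤ n ∧ y = betaCoef 2 n} (141 / 128) := by
  refine ⟨fun n ↦ betaCoef_half_nonneg, fun n ↦ betaCoef_one_ge,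
    fun n ↦ betaCoef_three_halves_ge, fun n ↦ betaCoef_two_ge, ?_, betaCoef_two_two,
    ⟨2, by norm_num, betaCoef_two_two.symm⟩, ?_⟩
  · rw [betaCoef_two_eq (by norm_num)]
    norm_num
  · rintro _ ⟨n, hn, rfl⟩
    rcases lt_or_ge n 4 with h | h
    · rw [betaCoef_two_eq hn]
      interval_cases n <;> norm_num
    · exact le_trans (by norm_num) (betaCoef_two_ge h)
end

section
/- Let 0 ≤ λ ≤ 3/2 and let f : [−1,1] → ℝ be continuously differentiable with c_λ∫_{−1}^{1} f(t) w_λ(t) dt = 0 and c_λ∫_{−1}^{1} f(t)² w_λ(t) dt = 1. Then ( c_λ∫_{−1}^{1} (1−t) f(t)² w_λ(t) dt ) · ( c_λ∫_{−1}^{1} (1−t²) f′(t)² w_λ(t) dt ) ≥ B_λ, where B_λ = (2λ−1)²/8 if λ ≠ 1/2, and B_{1/2} = 2 − 2√6/3. -/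
open MeasureTheory Real

/-- The Gegenbauer weight `w_λ(t) = (1-t²)^{λ-1/2}` on `[-1,1]`. -/
noncomputable def gegenWeight (lam t : ℝ) : ℝ := (1 - t ^ 2) ^ (lam - 1 / 2)

/-- The normalization constant `c_λ = Γ(λ+1)/(√π Γ(λ+1/2))`,
so that `c_λ ∫_{-1}^1 w_λ(t) dt = 1`. -/
noncomputable def gegenConst (lam : ℝ) : ℝ :=
  Real.Gamma (lam + 1) / (Real.sqrt Real.pi * Real.Gamma (lam + 1 / 2))

/-- The constant `B_λ` in the Gegenbauer uncertainty principle: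
`B_λ = (2λ-1)²/8` for `λ ≠ 1/2` and `B_{1/2} = 2 - 2√6/3`. -/
noncomputable def gegenUPConst (lam : ℝ) : ℝ :=
  if lam = 1 / 2 then 2 - 2 * Real.sqrt 6 / 3 else (2 * lam - 1) ^ 2 / 8

open Set Filter Topology

lemma one_sub_sq_pos_of_mem_Ioo {t : ℝ} (ht : t ∈ Ioo (-1 : ℝ) 1) : 0 < 1 - t ^ 2 := by
  nlinarith [ht.1, ht.2]

lemma gegenWeight_pos (lam : ℝ) {t : ℝ} (ht : t ∈ Ioo (-1 : ℝ) 1) : 0 < gegenWeight lam t :=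
  rpow_pos_of_pos (one_sub_sq_pos_of_mem_Ioo ht) _

lemma rpow_add_half_eq_mul_gegenWeight (lam : ℝ) {t : ℝ} (ht : t ∈ Ioo (-1 : ℝ) 1) :
    (1 - t ^ 2) ^ (lam + 1 / 2) = (1 - t ^ 2) * gegenWeight lam t := by
  rw [show lam + 1 / 2 = 1 + (lam - 1 / 2) by ring, rpow_add (one_sub_sq_pos_of_mem_Ioo ht),
    rpow_one, gegenWeight]

lemma continuousOn_gegenWeight (lam : ℝ) : ContinuousOn (gegenWeight lam) (Ioo (-1 : ℝ) 1) := by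
  unfold gegenWeight
  refine ContinuousOn.rpow_const (by fun_prop) fun t ht => Or.inl ?_
  exact (one_sub_sq_pos_of_mem_Ioo ht).ne'

/-- Dominated by the derivative of `arcsin`. -/
lemma integrableOn_gegenWeight {lam : ℝ} (hlam : 0 ≤ lam) :
    IntegrableOn (gegenWeight lam) (Icc (-1 : ℝ) 1) := by
  have harcsin : IntegrableOn (fun t : ℝ => 1 / √(1 - t ^ 2)) (Ioc (-1 : ℝ) 1) :=
    intervalIntegral.integrableOn_deriv_of_nonneg continuous_arcsin.continuousOn
      (fun t ht => hasDerivAt_arcsin ht.1.ne' ht.2.ne) fun t _ => by positivity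
  rw [integrableOn_Icc_iff_integrableOn_Ioo]
  refine Integrable.mono' (harcsin.mono_set Ioo_subset_Ioc_self)
    ((continuousOn_gegenWeight lam).aestronglyMeasurable measurableSet_Ioo) ?_
  refine (ae_restrict_iff' measurableSet_Ioo).2 (Eventually.of_forall fun t ht => ?_)
  have hpos := one_sub_sq_pos_of_mem_Ioo ht
  rw [norm_of_nonneg (gegenWeight_pos lam ht).le, gegenWeight, sqrt_eq_rpow, one_div (_ ^ _),
    ← rpow_neg hpos.le]
  exact rpow_le_rpow_of_exponent_ge hpos (by nlinarith [sq_nonneg t]) (by linarith)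

lemma hasDerivAt_rpow_add_half (lam : ℝ) {t : ℝ} (ht : t ∈ Ioo (-1 : ℝ) 1) :
    HasDerivAt (fun s : ℝ => (1 - s ^ 2) ^ (lam + 1 / 2))
      (-(2 * lam + 1) * t * gegenWeight lam t) t := by
  have h := (((hasDerivAt_id' t).fun_pow 2).const_sub 1).rpow_const (p := lam + 1 / 2)
    (Or.inl (one_sub_sq_pos_of_mem_Ioo ht).ne')
  refine h.congr_deriv ?_
  rw [gegenWeight, show lam - 1 / 2 = lam + 1 / 2 - 1 by ring]
  simp only [Nat.cast_ofNat]
  ring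

lemma continuous_rpow_add_half {lam : ℝ} (hlam : 0 ≤ lam) :
    Continuous fun t : ℝ => (1 - t ^ 2) ^ (lam + 1 / 2) :=
  Continuous.rpow_const (by fun_prop) fun _ => Or.inr (by linarith)

section Primitive

variable {lam : ℝ} {f G : ℝ → ℝ}

lemma primitive_le_rpow_add_half (hlam : 0 ≤ lam) {M : ℝ}
    (hM : ∀ t ∈ Icc (-1 : ℝ) 1, |f t| ≤ M) (hG : ContinuousOn G (Icc (-1 : ℝ) 1))
    (hG1 : G 1 = 0)
    (hGd : ∀ t ∈ Ioo (-1 : ℝ) 1, HasDerivAt G (f t * gegenWeight lam t) t)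
    {t : ℝ} (ht : t ∈ Icc (1 / 2 : ℝ) 1) :
    G t ≤ 2 * M * (1 - t ^ 2) ^ (lam + 1 / 2) := by
  have hsub : Ioo (1 / 2 : ℝ) 1 ⊆ Ioo (-1) 1 := Ioo_subset_Ioo_left (by norm_num)
  have hd : ∀ s ∈ Ioo (1 / 2 : ℝ) 1,
      HasDerivAt (fun s : ℝ => 2 * M * (1 - s ^ 2) ^ (lam + 1 / 2) - G s)
        (2 * M * (-(2 * lam + 1) * s * gegenWeight lam s) - f s * gegenWeight lam s) s :=
    fun s hs => ((hasDerivAt_rpow_add_half lam (hsub hs)).const_mul _).sub (hGd s (hsub hs))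
  have hanti : AntitoneOn (fun s : ℝ => 2 * M * (1 - s ^ 2) ^ (lam + 1 / 2) - G s)
      (Icc (1 / 2 : ℝ) 1) := by
    refine antitoneOn_of_deriv_nonpos (convex_Icc _ _) ?_ ?_ ?_
    · exact ((continuous_rpow_add_half hlam).continuousOn.const_mul _).sub
        (hG.mono (Icc_subset_Icc_left (by norm_num)))
    · rw [interior_Icc]
      exact fun s hs => (hd s hs).differentiableAt.differentiableWithinAt
    · rw [interior_Icc]
      intro s hs
      rw [(hd s hs).deriv]
      have hw := gegenWeight_pos lam (hsub hs)
      have hf := abs_le.1 (hM s (Ioo_subset_Icc_self (hsub hs)))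
      have hM0 : 0 ≤ M := by linarith
      have h1 : 1 ≤ 2 * ((2 * lam + 1) * s) := by nlinarith [hs.1]
      have h2 : 0 ≤ 2 * M * ((2 * lam + 1) * s) + f s := by nlinarith
      nlinarith
  have h := hanti ht (right_mem_Icc.2 (by norm_num)) ht.2
  have h0 : (0 : ℝ) ^ (lam + 1 / 2) = 0 := zero_rpow (by linarith)
  simp only [one_pow, sub_self, h0, hG1] at h
  linarith

lemma abs_primitive_le_rpow_add_half (hlam : 0 ≤ lam) {M : ℝ}
    (hM : ∀ t ∈ Icc (-1 : ℝ) 1, |f t| ≤ M) (hG : ContinuousOn G (Icc (-1 : ℝ) 1))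
    (hG1 : G 1 = 0)
    (hGd : ∀ t ∈ Ioo (-1 : ℝ) 1, HasDerivAt G (f t * gegenWeight lam t) t)
    {t : ℝ} (ht : t ∈ Icc (1 / 2 : ℝ) 1) :
    |G t| ≤ 2 * M * (1 - t ^ 2) ^ (lam + 1 / 2) := by
  refine abs_le'.2 ⟨primitive_le_rpow_add_half hlam hM hG hG1 hGd ht, ?_⟩
  refine primitive_le_rpow_add_half (f := fun s => -f s) (G := fun s => -G s) hlam
    (fun s hs => by simpa using hM s hs) hG.neg (by simpa using hG1) (fun s hs => ?_) ht
  simpa using (hGd s hs).fun_neg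

lemma abs_primitive_le_rpow_add_half_of_half_le_abs (hlam : 0 ≤ lam) {M : ℝ}
    (hM : ∀ t ∈ Icc (-1 : ℝ) 1, |f t| ≤ M) (hG : ContinuousOn G (Icc (-1 : ℝ) 1))
    (hGneg : G (-1) = 0) (hG1 : G 1 = 0)
    (hGd : ∀ t ∈ Ioo (-1 : ℝ) 1, HasDerivAt G (f t * gegenWeight lam t) t)
    {t : ℝ} (ht : t ∈ Icc (-1 : ℝ) 1) (hhalf : 1 / 2 ≤ |t|) :
    |G t| ≤ 2 * M * (1 - t ^ 2) ^ (lam + 1 / 2) := by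
  rcases le_abs.1 hhalf with h | h
  · exact abs_primitive_le_rpow_add_half hlam hM hG hG1 hGd ⟨h, ht.2⟩
  · have key := abs_primitive_le_rpow_add_half (f := fun s => -f (-s)) (G := fun s => G (-s))
      (t := -t) hlam (M := M) (fun s hs => ?_) ?_ hGneg (fun s hs => ?_) ⟨h, by linarith [ht.1]⟩
    · simpa using key
    · simpa using hM (-s) ⟨by linarith [hs.2], by linarith [hs.1]⟩
    · exact hG.comp continuousOn_neg fun s hs => ⟨by linarith [hs.2], by linarith [hs.1]⟩
    · have := (hGd (-s) ⟨by linarith [hs.2], by linarith [hs.1]⟩).comp s (hasDerivAt_neg s)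
      refine this.congr_deriv ?_
      simp [gegenWeight]

/-- The boundary term of the weighted Hardy inequality vanishes at the endpoints. -/
lemma continuousOn_div_rpow_mul_primitive_sq (hlam : 0 ≤ lam) {M : ℝ}
    (hM : ∀ t ∈ Icc (-1 : ℝ) 1, |f t| ≤ M) (hG : ContinuousOn G (Icc (-1 : ℝ) 1))
    (hGneg : G (-1) = 0) (hG1 : G 1 = 0)
    (hGd : ∀ t ∈ Ioo (-1 : ℝ) 1, HasDerivAt G (f t * gegenWeight lam t) t)
    {R : ℝ → ℝ} (hR : Continuous R) :
    ContinuousOn (fun t => R t / (1 - t ^ 2) ^ (lam + 1 / 2) * G t ^ 2) (Icc (-1 : ℝ) 1) := by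
  have hendpoint : ∀ t : ℝ, |t| = 1 → G t = 0 → ContinuousWithinAt
      (fun t => R t / (1 - t ^ 2) ^ (lam + 1 / 2) * G t ^ 2) (Icc (-1 : ℝ) 1) t := by
    intro t htabs hGt
    have htsq : 1 - t ^ 2 = 0 := by rw [← sq_abs, htabs]; norm_num
    have h0 : (0 : ℝ) ^ (lam + 1 / 2) = 0 := zero_rpow (by linarith)
    have hval : R t / (1 - t ^ 2) ^ (lam + 1 / 2) * G t ^ 2 = 0 := by simp [hGt]
    rw [ContinuousWithinAt, hval]
    have hbound : Tendsto (fun s : ℝ => |R s| * (2 * M) ^ 2 * (1 - s ^ 2) ^ (lam + 1 / 2))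
        (𝓝[Icc (-1 : ℝ) 1] t) (𝓝 0) := by
      have hc : Continuous fun s : ℝ => |R s| * (2 * M) ^ 2 * (1 - s ^ 2) ^ (lam + 1 / 2) :=
        (hR.abs.mul continuous_const).mul (continuous_rpow_add_half hlam)
      have := hc.tendsto t
      rw [htsq, h0, mul_zero] at this
      exact this.mono_left nhdsWithin_le_nhds
    refine squeeze_zero_norm' ?_ hbound
    have hnear : ∀ᶠ s in 𝓝[Icc (-1 : ℝ) 1] t, 1 / 2 < |s| :=
      nhdsWithin_le_nhds (continuous_abs.continuousAt.eventually (lt_mem_nhds (by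
        rw [htabs]; norm_num)))
    filter_upwards [hnear, self_mem_nhdsWithin] with s hs hsI
    have hGs := abs_primitive_le_rpow_add_half_of_half_le_abs hlam hM hG hGneg hG1 hGd hsI hs.le
    have hW : 0 ≤ (1 - s ^ 2) ^ (lam + 1 / 2) :=
      rpow_nonneg (by nlinarith [hsI.1, hsI.2]) _
    rw [norm_eq_abs, abs_mul, abs_div, abs_of_nonneg hW, abs_pow]
    rcases hW.eq_or_lt with h | h
    · rw [← h]; simp
    · calc |R s| / (1 - s ^ 2) ^ (lam + 1 / 2) * |G s| ^ 2
          ≤ |R s| / (1 - s ^ 2) ^ (lam + 1 / 2) *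
            (2 * M * (1 - s ^ 2) ^ (lam + 1 / 2)) ^ 2 := by gcongr
        _ = |R s| * (2 * M) ^ 2 * (1 - s ^ 2) ^ (lam + 1 / 2) := by field_simp
  intro t ht
  rcases ht.1.eq_or_lt with h | h
  · subst h; exact hendpoint _ (by norm_num) hGneg
  rcases ht.2.eq_or_lt with h' | h'
  · subst h'; exact hendpoint _ (by norm_num) hG1
  have hIoo : t ∈ Ioo (-1 : ℝ) 1 := ⟨h, h'⟩
  refine ContinuousAt.continuousWithinAt ?_
  refine (hR.continuousAt.div (continuous_rpow_add_half hlam).continuousAt ?_).mul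
    ((hGd t hIoo).continuousAt.pow 2)
  exact (rpow_pos_of_pos (one_sub_sq_pos_of_mem_Ioo hIoo) _).ne'

end Primitive

section C1

variable {lam : ℝ} {f : ℝ → ℝ}

lemma ContDiffOn.hasDerivAt_derivWithin_Icc (hf : ContDiffOn ℝ 1 f (Icc (-1 : ℝ) 1)) {t : ℝ}
    (ht : t ∈ Ioo (-1 : ℝ) 1) : HasDerivAt f (derivWithin f (Icc (-1 : ℝ) 1) t) t :=
  ((hf.differentiableOn one_ne_zero) t (Ioo_subset_Icc_self ht)).hasDerivWithinAt.hasDerivAt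
    (Icc_mem_nhds ht.1 ht.2)

lemma ContDiffOn.continuousOn_derivWithin_Icc (hf : ContDiffOn ℝ 1 f (Icc (-1 : ℝ) 1)) :
    ContinuousOn (derivWithin f (Icc (-1 : ℝ) 1)) (Icc (-1 : ℝ) 1) :=
  hf.continuousOn_derivWithin (uniqueDiffOn_Icc (by norm_num)) le_rfl

lemma integrableOn_mul_gegenWeight (hlam : 0 ≤ lam) {g : ℝ → ℝ}
    (hg : ContinuousOn g (Icc (-1 : ℝ) 1)) :
    IntegrableOn (fun t => g t * gegenWeight lam t) (Icc (-1 : ℝ) 1) :=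
  (integrableOn_gegenWeight hlam).continuousOn_mul hg isCompact_Icc

lemma intervalIntegrable_mul_gegenWeight (hlam : 0 ≤ lam) {g : ℝ → ℝ}
    (hg : ContinuousOn g (Icc (-1 : ℝ) 1)) :
    IntervalIntegrable (fun t => g t * gegenWeight lam t) volume (-1) 1 :=
  (intervalIntegrable_iff_integrableOn_Icc_of_le (by norm_num)).2
    (integrableOn_mul_gegenWeight hlam hg)

/-- A mean-zero function has a primitive, against the Gegenbauer weight, vanishing at `±1`. -/
lemma exists_gegenWeight_primitive (hlam : 0 ≤ lam) (hf : ContinuousOn f (Icc (-1 : ℝ) 1))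
    (hmean : ∫ t in (-1 : ℝ)..1, f t * gegenWeight lam t = 0) :
    ∃ G : ℝ → ℝ, ContinuousOn G (Icc (-1 : ℝ) 1) ∧ G (-1) = 0 ∧ G 1 = 0 ∧
      ∀ t ∈ Ioo (-1 : ℝ) 1, HasDerivAt G (f t * gegenWeight lam t) t := by
  have huIcc : uIcc (-1 : ℝ) 1 = Icc (-1) 1 := uIcc_of_le (by norm_num)
  refine ⟨fun t => ∫ s in (-1 : ℝ)..t, f s * gegenWeight lam s, ?_, by simp, hmean, ?_⟩
  · have := intervalIntegral.continuousOn_primitive_interval (a := (-1 : ℝ)) (b := 1)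
      (by rw [huIcc]; exact integrableOn_mul_gegenWeight hlam hf)
    rwa [huIcc] at this
  · intro t ht
    have hc : ContinuousOn (fun s => f s * gegenWeight lam s) (Ioo (-1 : ℝ) 1) :=
      (hf.mono Ioo_subset_Icc_self).mul (continuousOn_gegenWeight lam)
    refine intervalIntegral.integral_hasDerivAt_right ?_
      (hc.stronglyMeasurableAtFilter isOpen_Ioo t ht) (hc.continuousAt (isOpen_Ioo.mem_nhds ht))
    refine (intervalIntegrable_mul_gegenWeight hlam hf).mono_set ?_
    rw [huIcc, uIcc_of_le ht.1.le]
    exact Icc_subset_Icc_right ht.2.le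

lemma quadratic_form_nonneg {y v k t p R R' κ a b g w : ℝ} (hy : 0 < y) (hv : 0 < v) (hk : 0 < k)
    (hw : 0 < w) (hRic : R ^ 2 + k * v * y ≤ v * y * R' + 2 * p * t * v * R) :
    0 ≤ w * (y * (b + κ * g) ^ 2 + κ ^ 2 / k *
      (v * a ^ 2 + 2 * R * g * a + (y * R' + 2 * p * t * R - k * y) * g ^ 2)) := by
  have h1 : 0 ≤ v * (v * a ^ 2 + 2 * R * g * a + (y * R' + 2 * p * t * R - k * y) * g ^ 2) := by
    nlinarith [sq_nonneg (v * a + R * g), mul_nonneg (sub_nonneg.2 hRic) (sq_nonneg g)]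
  have h2 := nonneg_of_mul_nonneg_right h1 hv
  positivity

/-- A Hardy-type uncertainty inequality: every solution `R` of the Riccati inequality `hRic`
bounds the product of `∫ v f² w` and the Dirichlet form from below. -/
lemma hardy_uncertainty (hlam : 0 ≤ lam) (hf : ContDiffOn ℝ 1 f (Icc (-1 : ℝ) 1))
    (hmean : ∫ t in (-1 : ℝ)..1, f t * gegenWeight lam t = 0)
    {R R' v : ℝ → ℝ} {k : ℝ} (hk : 0 < k) (hR : ∀ t, HasDerivAt R (R' t) t)
    (hv : Continuous v) (hvpos : ∀ t ∈ Ioo (-1 : ℝ) 1, 0 < v t)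
    (hRic : ∀ t ∈ Ioo (-1 : ℝ) 1, R t ^ 2 + k * v t * (1 - t ^ 2) ≤
      v t * (1 - t ^ 2) * R' t + 2 * (lam + 1 / 2) * t * v t * R t) (κ : ℝ) :
    2 * κ * (∫ t in (-1 : ℝ)..1, f t ^ 2 * gegenWeight lam t) ≤
      (∫ t in (-1 : ℝ)..1,
        (1 - t ^ 2) * (derivWithin f (Icc (-1 : ℝ) 1) t) ^ 2 * gegenWeight lam t) +
      κ ^ 2 / k * ∫ t in (-1 : ℝ)..1, v t * f t ^ 2 * gegenWeight lam t := by
  obtain ⟨G, hG, hGneg, hG1, hGd⟩ := exists_gegenWeight_primitive hlam hf.continuousOn hmean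
  obtain ⟨M, hM⟩ := isCompact_Icc.exists_bound_of_continuousOn hf.continuousOn
  have hRc : Continuous R := continuous_iff_continuousAt.2 fun t => (hR t).continuousAt
  have hcf := hf.continuousOn
  have hcf' := hf.continuousOn_derivWithin_Icc
  set D := derivWithin f (Icc (-1 : ℝ) 1) with hD
  have hi1 := intervalIntegrable_mul_gegenWeight (g := fun t => f t ^ 2) hlam
    (by fun_prop)
  have hi2 := intervalIntegrable_mul_gegenWeight (g := fun t => (1 - t ^ 2) * D t ^ 2) hlam
    (by fun_prop)
  have hi3 := intervalIntegrable_mul_gegenWeight (g := fun t => v t * f t ^ 2) hlam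
    (by fun_prop)
  have hcont : ContinuousOn (fun t => 2 * κ * (f t * G t) +
      κ ^ 2 / k * (R t / (1 - t ^ 2) ^ (lam + 1 / 2) * G t ^ 2)) (Icc (-1 : ℝ) 1) :=
    ((hcf.mul hG).const_mul _).add ((continuousOn_div_rpow_mul_primitive_sq hlam hM hG hGneg hG1
      hGd hRc).const_mul _)
  have hderiv : ∀ t ∈ Ioo (-1 : ℝ) 1, HasDerivAt (fun t => 2 * κ * (f t * G t) +
      κ ^ 2 / k * (R t / (1 - t ^ 2) ^ (lam + 1 / 2) * G t ^ 2))
      (2 * κ * (D t * G t + f t * (f t * gegenWeight lam t)) + κ ^ 2 / k *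
        ((R' t * (1 - t ^ 2) ^ (lam + 1 / 2) -
          R t * (-(2 * lam + 1) * t * gegenWeight lam t)) / ((1 - t ^ 2) ^ (lam + 1 / 2)) ^ 2 *
          G t ^ 2 + R t / (1 - t ^ 2) ^ (lam + 1 / 2) *
          (2 * G t * (f t * gegenWeight lam t)))) t := by
    intro t ht
    have hW : (1 - t ^ 2) ^ (lam + 1 / 2) ≠ 0 :=
      (rpow_pos_of_pos (one_sub_sq_pos_of_mem_Ioo ht) _).ne'
    have hG2 := (hGd t ht).fun_pow 2
    simp only [Nat.cast_ofNat, Nat.add_one_sub_one, pow_one] at hG2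
    exact (((hf.hasDerivAt_derivWithin_Icc ht).mul (hGd t ht)).const_mul _).add
      ((((hR t).div (hasDerivAt_rpow_add_half lam ht) hW).mul hG2).const_mul _)
  have hmain := intervalIntegral.integral_le_sub_of_hasDeriv_right_of_le
    (φ := fun t => 2 * κ * (f t ^ 2 * gegenWeight lam t) -
      (1 - t ^ 2) * D t ^ 2 * gegenWeight lam t -
      κ ^ 2 / k * (v t * f t ^ 2 * gegenWeight lam t))
    (by norm_num : (-1 : ℝ) ≤ 1) hcont (fun t ht => (hderiv t ht).hasDerivWithinAt)
    ((intervalIntegrable_iff_integrableOn_Icc_of_le (by norm_num)).1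
      (((hi1.const_mul _).sub hi2).sub (hi3.const_mul _))) (by
    intro t ht
    have hy := one_sub_sq_pos_of_mem_Ioo ht
    have hw := gegenWeight_pos lam ht
    rw [rpow_add_half_eq_mul_gegenWeight lam ht]
    have hq := quadratic_form_nonneg (κ := κ) (a := f t) (b := D t)
      (g := G t / ((1 - t ^ 2) * gegenWeight lam t)) hy (hvpos t ht) hk hw (hRic t ht)
    rw [← sub_nonneg]
    refine hq.trans_eq ?_
    generalize gegenWeight lam t = w at *
    generalize 1 - t ^ 2 = y at *
    field_simp
    ring)
  rw [intervalIntegral.integral_sub ((hi1.const_mul _).sub hi2) (hi3.const_mul _),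
    intervalIntegral.integral_sub (hi1.const_mul _) hi2,
    intervalIntegral.integral_const_mul, intervalIntegral.integral_const_mul] at hmain
  simp only [hGneg, hG1] at hmain
  norm_num at hmain ⊢
  linarith

/-- The product form of `hardy_uncertainty`, for an arbitrary normalization constant `c`. -/
lemma hardy_uncertainty_mul (hlam : 0 ≤ lam) (hf : ContDiffOn ℝ 1 f (Icc (-1 : ℝ) 1))
    (hmean : ∫ t in (-1 : ℝ)..1, f t * gegenWeight lam t = 0) {c : ℝ} (hc : 0 < c)
    (hnorm : c * (∫ t in (-1 : ℝ)..1, f t ^ 2 * gegenWeight lam t) = 1)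
    {R R' v : ℝ → ℝ} {k : ℝ} (hk : 0 < k) (hR : ∀ t, HasDerivAt R (R' t) t)
    (hv : Continuous v) (hvpos : ∀ t ∈ Ioo (-1 : ℝ) 1, 0 < v t)
    (hRic : ∀ t ∈ Ioo (-1 : ℝ) 1, R t ^ 2 + k * v t * (1 - t ^ 2) ≤
      v t * (1 - t ^ 2) * R' t + 2 * (lam + 1 / 2) * t * v t * R t) :
    k ≤ (c * ∫ t in (-1 : ℝ)..1, v t * f t ^ 2 * gegenWeight lam t) *
      (c * ∫ t in (-1 : ℝ)..1,
        (1 - t ^ 2) * (derivWithin f (Icc (-1 : ℝ) 1) t) ^ 2 * gegenWeight lam t) := by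
  have h := hardy_uncertainty hlam hf hmean hk hR hv hvpos hRic
  set T := ∫ t in (-1 : ℝ)..1, v t * f t ^ 2 * gegenWeight lam t
  set E := ∫ t in (-1 : ℝ)..1,
    (1 - t ^ 2) * (derivWithin f (Icc (-1 : ℝ) 1) t) ^ 2 * gegenWeight lam t
  have hdisc := discrim_le_zero (a := c * T / k) (b := -2) (c := c * E) fun κ => by
    have h1 := mul_le_mul_of_nonneg_left (h κ) hc.le
    have h2 : c * (2 * κ * ∫ t in (-1 : ℝ)..1, f t ^ 2 * gegenWeight lam t) = 2 * κ := by
      linear_combination 2 * κ * hnorm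
    rw [h2] at h1
    have h3 : c * T / k * (κ * κ) + -2 * κ + c * E = c * (E + κ ^ 2 / k * T) - 2 * κ := by ring
    linarith
  rw [discrim] at hdisc
  have h4 : 1 ≤ c * T * (c * E) / k := by
    have : c * T / k * (c * E) = c * T * (c * E) / k := by ring
    linarith
  rwa [one_le_div hk] at h4

/-- The Heisenberg-type inequality obtained from Cauchy-Schwarz and integration by parts. -/
lemma sq_mean_le_dirichlet (hlam : 0 ≤ lam) (hf : ContDiffOn ℝ 1 f (Icc (-1 : ℝ) 1))
    {c : ℝ} (hc : 0 < c)
    (hnorm : c * (∫ t in (-1 : ℝ)..1, f t ^ 2 * gegenWeight lam t) = 1)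
    {m : ℝ} (hm : c * (∫ t in (-1 : ℝ)..1, t * f t ^ 2 * gegenWeight lam t) = m) :
    ((lam + 1 / 2) * m) ^ 2 ≤ (c * ∫ t in (-1 : ℝ)..1,
        (1 - t ^ 2) * (derivWithin f (Icc (-1 : ℝ) 1) t) ^ 2 * gegenWeight lam t) *
      (1 - m ^ 2) := by
  have hcf := hf.continuousOn
  have hcf' := hf.continuousOn_derivWithin_Icc
  set D := derivWithin f (Icc (-1 : ℝ) 1) with hD
  have hi0 := intervalIntegrable_mul_gegenWeight (g := fun t => f t ^ 2) hlam (by fun_prop)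
  have hi1 := intervalIntegrable_mul_gegenWeight (g := fun t => t * f t ^ 2) hlam (by fun_prop)
  have hi2 := intervalIntegrable_mul_gegenWeight (g := fun t => (1 - t ^ 2) * D t ^ 2) hlam
    (by fun_prop)
  have hi2' : IntervalIntegrable (fun t => -((1 - t ^ 2) * D t ^ 2 * gegenWeight lam t))
      volume (-1) 1 := hi2.neg
  set I0 := ∫ t in (-1 : ℝ)..1, f t ^ 2 * gegenWeight lam t
  set I1 := ∫ t in (-1 : ℝ)..1, t * f t ^ 2 * gegenWeight lam t
  set E := ∫ t in (-1 : ℝ)..1, (1 - t ^ 2) * D t ^ 2 * gegenWeight lam t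
  have h0 : (0 : ℝ) ^ (lam + 1 / 2) = 0 := zero_rpow (by linarith)
  have hineq : ∀ κ : ℝ, 0 ≤ E + κ * ((2 * lam + 1) * I1) +
      κ ^ 2 * ((1 + m ^ 2) * I0 - 2 * m * I1) := by
    intro κ
    have hmain := intervalIntegral.integral_le_sub_of_hasDeriv_right_of_le
      (g := fun t => κ * ((1 - t ^ 2) ^ (lam + 1 / 2) * f t ^ 2))
      (φ := fun t => -((1 - t ^ 2) * D t ^ 2 * gegenWeight lam t) -
        (κ * (2 * lam + 1) - 2 * m * κ ^ 2) * (t * f t ^ 2 * gegenWeight lam t) -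
        κ ^ 2 * (1 + m ^ 2) * (f t ^ 2 * gegenWeight lam t))
      (by norm_num : (-1 : ℝ) ≤ 1)
      (((continuous_rpow_add_half hlam).continuousOn.mul (hcf.pow 2)).const_mul κ)
      (fun t ht => (((hasDerivAt_rpow_add_half lam ht).mul
        ((hf.hasDerivAt_derivWithin_Icc ht).fun_pow 2)).const_mul κ).hasDerivWithinAt)
      ((intervalIntegrable_iff_integrableOn_Icc_of_le (by norm_num)).1
        ((hi2'.sub (hi1.const_mul _)).sub (hi0.const_mul _))) (by
      intro t ht
      have hy := one_sub_sq_pos_of_mem_Ioo ht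
      have hw := gegenWeight_pos lam ht
      rw [rpow_add_half_eq_mul_gegenWeight lam ht, ← hD, ← sub_nonneg]
      have hsq : 0 ≤ gegenWeight lam t * ((1 - t ^ 2) * (D t + κ * f t) ^ 2 +
        κ ^ 2 * ((t - m) * f t) ^ 2) := by positivity
      refine hsq.trans_eq ?_
      simp only [Nat.cast_ofNat, Nat.add_one_sub_one, pow_one]
      ring)
    rw [intervalIntegral.integral_sub (hi2'.sub (hi1.const_mul _)) (hi0.const_mul _),
      intervalIntegral.integral_sub hi2' (hi1.const_mul _), intervalIntegral.integral_neg,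
      intervalIntegral.integral_const_mul, intervalIntegral.integral_const_mul] at hmain
    simp only [one_pow, even_two, Even.neg_pow, sub_self, h0, zero_mul, mul_zero] at hmain
    linarith
  have hdisc := discrim_le_zero (a := 1 - m ^ 2) (b := (2 * lam + 1) * m) (c := c * E)
    fun κ => by
      have h1 := mul_nonneg hc.le (hineq κ)
      have h2 : (1 - m ^ 2) * (κ * κ) + (2 * lam + 1) * m * κ + c * E =
          c * (E + κ * ((2 * lam + 1) * I1) + κ ^ 2 * ((1 + m ^ 2) * I0 - 2 * m * I1)) := by
        linear_combination (-κ * (2 * lam + 1) + 2 * m * κ ^ 2) * hm -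
          κ ^ 2 * (1 + m ^ 2) * hnorm
      rwa [h2]
  rw [discrim] at hdisc
  linarith

end C1

lemma gegenConst_pos {lam : ℝ} (hlam : 0 ≤ lam) : 0 < gegenConst lam :=
  div_pos (Gamma_pos_of_pos (by linarith))
    (mul_pos (sqrt_pos.2 pi_pos) (Gamma_pos_of_pos (by linarith)))

lemma mul_ge_of_heisenberg_of_poincare {τ E : ℝ} (hτ : 0 ≤ τ) (hE : 2 ≤ E)
    (h : (1 - τ) ^ 2 ≤ E * (1 - (1 - τ) ^ 2)) : 2 - 2 * √6 / 3 ≤ τ * E := by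
  have hs : √6 ^ 2 = 6 := sq_sqrt (by norm_num)
  have hs0 : 0 < √6 := sqrt_pos.2 (by norm_num)
  by_cases hcase : 1 - √6 / 3 ≤ τ
  · nlinarith
  · push Not at hcase
    have h1 : (1 - τ) ^ 2 ≤ τ * E * (2 - τ) := by linarith
    by_contra! hlt
    have hq : (2 - 2 * √6 / 3) * (2 - τ) ≤ (1 - τ) ^ 2 := by
      have hs2 : 2 < √6 := by nlinarith
      have hprod : 0 < (1 - τ - √6 / 3) * (1 - τ + √6 - 2) :=
        mul_pos (by linarith) (by linarith)
      nlinarith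
    nlinarith

/-- **Corollary 4.2 (uncertainty principle for Gegenbauer expansions).** Let `0 ≤ λ ≤ 3/2`
and let `f` be `C¹` on `[-1,1]` with `c_λ ∫ f w_λ = 0` and `c_λ ∫ f² w_λ = 1`. Then
`(c_λ ∫ (1-t) f² w_λ)(c_λ ∫ (1-t²) f'² w_λ) ≥ B_λ`. -/
theorem uncertainty_principle_gegenbauer (lam : ℝ) (hlam0 : 0 ≤ lam) (hlam1 : lam ≤ 3 / 2)
    (f : ℝ → ℝ) (hf : ContDiffOn ℝ 1 f (Set.Icc (-1 : ℝ) 1))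
    (hmean : gegenConst lam * (∫ t in (-1 : ℝ)..1, f t * gegenWeight lam t) = 0)
    (hnorm : gegenConst lam * (∫ t in (-1 : ℝ)..1, f t ^ 2 * gegenWeight lam t) = 1) :
    (gegenConst lam * ∫ t in (-1 : ℝ)..1, (1 - t) * f t ^ 2 * gegenWeight lam t) *
      (gegenConst lam * ∫ t in (-1 : ℝ)..1,
        (1 - t ^ 2) * (derivWithin f (Set.Icc (-1 : ℝ) 1) t) ^ 2 * gegenWeight lam t) ≥
      gegenUPConst lam := by
  have hc := gegenConst_pos hlam0
  have hmean' := (mul_eq_zero.1 hmean).resolve_left hc.ne'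
  unfold gegenUPConst
  split_ifs with hlam
  · have hP := hardy_uncertainty_mul hlam0 hf hmean' hc hnorm (R := fun t => 2 * t)
      (R' := fun _ => 2) (v := fun _ => 1) (k := 2) two_pos
      (fun t => by simpa using (hasDerivAt_id t).const_mul 2) continuous_const
      (fun _ _ => one_pos) (fun t _ => by rw [hlam]; apply le_of_eq; ring)
    simp only [one_mul, hnorm] at hP
    have hcf := hf.continuousOn
    have hi0 := intervalIntegrable_mul_gegenWeight (g := fun t => f t ^ 2) hlam0 (by fun_prop)
    have hi1 := intervalIntegrable_mul_gegenWeight (g := fun t => (1 - t) * f t ^ 2) hlam0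
      (by fun_prop)
    set τ := gegenConst lam * ∫ t in (-1 : ℝ)..1, (1 - t) * f t ^ 2 * gegenWeight lam t with hτ
    have hm : gegenConst lam * (∫ t in (-1 : ℝ)..1, t * f t ^ 2 * gegenWeight lam t) =
        1 - τ := by
      have hsub := intervalIntegral.integral_sub hi0 hi1
      have hcongr : ∫ t in (-1 : ℝ)..1, t * f t ^ 2 * gegenWeight lam t =
          ∫ t in (-1 : ℝ)..1,
            (f t ^ 2 * gegenWeight lam t - (1 - t) * f t ^ 2 * gegenWeight lam t) := by
        congr 1
        ext t
        ring
      rw [hcongr, hsub, mul_sub, hnorm, hτ]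
    have hτ0 : 0 ≤ τ := by
      refine mul_nonneg hc.le (intervalIntegral.integral_nonneg (by norm_num) fun t ht => ?_)
      exact mul_nonneg (mul_nonneg (by linarith [ht.2]) (sq_nonneg _))
        (rpow_nonneg (by nlinarith [ht.1, ht.2]) _)
    have hCS := sq_mean_le_dirichlet hlam0 hf hc hnorm hm
    have hone : lam + 1 / 2 = 1 := by rw [hlam]; norm_num
    rw [hone, one_mul] at hCS
    exact mul_ge_of_heisenberg_of_poincare hτ0 hP hCS
  · have hk : 0 < (2 * lam - 1) ^ 2 / 8 := by
      have : 2 * lam - 1 ≠ 0 := fun h => hlam (by linarith)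
      positivity
    refine hardy_uncertainty_mul hlam0 hf hmean' hc hnorm hk
      (R := fun t => -(1 - t) * ((lam + 1 / 2) * (1 - t) + (1 / 2 - lam) / 2 * (1 + t)))
      (R' := fun t => (lam + 1 / 2) * (1 - t) + (1 / 2 - lam) / 2 * (1 + t) -
        (1 - t) * ((1 / 2 - lam) / 2 - (lam + 1 / 2))) (v := fun t => 1 - t)
      (fun t => ?_) (by fun_prop) (fun t ht => by linarith [ht.2]) (fun t ht => ?_)
    · have h1 : HasDerivAt (fun t : ℝ => 1 - t) (-1) t := (hasDerivAt_id t).const_sub 1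
      have h2 : HasDerivAt (fun t : ℝ => 1 + t) 1 t := (hasDerivAt_id t).const_add 1
      refine (h1.neg.mul ((h1.const_mul (lam + 1 / 2)).add
        (h2.const_mul ((1 / 2 - lam) / 2)))).congr_deriv ?_
      simp only [Pi.neg_apply, Pi.add_apply]
      ring
    · have hgap : 0 ≤ (lam + 1 / 2 - 3 / 4 * (1 / 2 - lam) ^ 2) *
          ((1 - t) ^ 3 * (1 + t)) := by
        have ht1 : 0 < 1 - t := by linarith [ht.2]
        have ht2 : 0 < 1 + t := by linarith [ht.1]
        have : 0 ≤ lam + 1 / 2 - 3 / 4 * (1 / 2 - lam) ^ 2 := by nlinarith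
        positivity
      rw [← sub_nonneg]
      refine hgap.trans_eq ?_
      ring
end

section
/- Let d ≥ 2 and let f : ℝ^d∖{0} → ℝ be continuously differentiable and positively homogeneous of degree 0 (f(tx) = f(x) for all t > 0 and x ≠ 0), with (1/ω_d)∫_{S^{d−1}} f(x)² dσ(x) = 1. Let τ(f) = (1/ω_d)∫_{S^{d−1}} x · f(x)² dσ(x) ∈ ℝ^d. Then (1 − ‖τ(f)‖²) · ( (1/ω_d)∫_{S^{d−1}} ‖∇f(x)‖² dσ(x) ) ≥ ((d−1)/2)² · ‖τ(f)‖². -/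
open MeasureTheory

/-- The surface measure on the unit sphere `S^{d-1} ⊆ ℝ^d`, obtained from Lebesgue
measure (total mass `ω_d = 2π^{d/2}/Γ(d/2)`). -/
noncomputable def sphereMeasure (d : ℕ) :
    Measure (Metric.sphere (0 : EuclideanSpace ℝ (Fin d)) 1) :=
  (volume : Measure (EuclideanSpace ℝ (Fin d))).toSphere

/-- The surface area `ω_d = 2π^{d/2}/Γ(d/2)` of `S^{d-1}`. -/
noncomputable def omegaSphere (d : ℕ) : ℝ :=
  2 * Real.pi ^ ((d : ℝ) / 2) / Real.Gamma ((d : ℝ) / 2)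

/-- The vector `τ(f) = (1/ω_d) ∫_{S^{d-1}} x f(x)² dσ(x) ∈ ℝ^d`. -/
noncomputable def tauVec (d : ℕ) (f : EuclideanSpace ℝ (Fin d) → ℝ) :
    EuclideanSpace ℝ (Fin d) :=
  (1 / omegaSphere d) • ∫ x : Metric.sphere (0 : EuclideanSpace ℝ (Fin d)) 1,
    f (x : EuclideanSpace ℝ (Fin d)) ^ 2 • (x : EuclideanSpace ℝ (Fin d)) ∂(sphereMeasure d)

open Set Metric Function
open scoped RealInnerProductSpace

section Polar

variable {E : Type*} [NormedAddCommGroup E] [NormedSpace ℝ E] [FiniteDimensional ℝ E]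
  [MeasurableSpace E] [BorelSpace E]

/-- Integration in polar coordinates of a function that splits into an angular and a radial
factor. -/
theorem integral_eq_integral_toSphere_mul_integral_Ioi [Nontrivial E] (μ : Measure E)
    [μ.IsAddHaarMeasure] {F : E → ℝ} (A : sphere (0 : E) 1 → ℝ) (k : ℝ → ℝ)
    (hF : ∀ (θ : sphere (0 : E) 1) (r : ℝ), 0 < r → F (r • (θ : E)) = A θ * k r) :
    ∫ x, F x ∂μ =
      (∫ θ, A θ ∂μ.toSphere) * ∫ r in Ioi (0 : ℝ), r ^ (Module.finrank ℝ E - 1) * k r := by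
  calc
    ∫ x, F x ∂μ = ∫ x : ({(0)}ᶜ : Set E), F x ∂(μ.comap (↑)) := by
      rw [integral_subtype_comap (measurableSet_singleton _).compl F, restrict_compl_singleton]
    _ = ∫ x, A x.1 * k x.2 ∂μ.toSphere.prod (.volumeIoiPow (Module.finrank ℝ E - 1)) := by
      rw [← μ.measurePreserving_homeomorphUnitSphereProd.integral_comp
        (Homeomorph.measurableEmbedding _)]
      refine integral_congr_ae (.of_forall fun x ↦ ?_)
      have h := hF (homeomorphUnitSphereProd E x).1 _ (homeomorphUnitSphereProd E x).2.2
      refine Eq.trans (congrArg F ?_) h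
      have h0 : ‖(x : E)‖ ≠ 0 := norm_ne_zero_iff.2 x.2
      simp [smul_smul, h0]
    _ = (∫ θ, A θ ∂μ.toSphere) *
          ∫ r : Ioi (0 : ℝ), k r ∂.volumeIoiPow (Module.finrank ℝ E - 1) :=
      integral_prod_mul A fun r : Ioi (0 : ℝ) ↦ k r
    _ = _ := by
      simp only [Measure.volumeIoiPow, ENNReal.ofReal]
      rw [integral_withDensity_eq_integral_smul,
        integral_subtype_comap measurableSet_Ioi
          fun a ↦ Real.toNNReal (a ^ (Module.finrank ℝ E - 1)) • k a,
        setIntegral_congr_fun measurableSet_Ioi fun x hx ↦ ?_]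
      · simp only [NNReal.smul_def, smul_eq_mul]
        rw [Real.coe_toNNReal _ (pow_nonneg hx.out.le _)]
      · exact (measurable_subtype_coe.pow_const _).real_toNNReal

end Polar

theorem integrable_mul_of_tsupport_subset {E : Type*} [NormedAddCommGroup E]
    [MeasurableSpace E] [BorelSpace E] {μ : Measure E} [IsFiniteMeasureOnCompacts μ] {U : Set E}
    {h w : E → ℝ} (hh : ContinuousOn h U) (hw : Continuous w)
    (hc : HasCompactSupport w) (hU : tsupport w ⊆ U) : Integrable (fun x ↦ h x * w x) μ := by
  rw [← integrableOn_iff_integrable_of_support_subset (s := tsupport w)]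
  · exact ((hh.mono hU).mul hw.continuousOn).integrableOn_compact hc
  · exact (support_mul_subset_right h w).trans (subset_tsupport w)

section Homogeneous

variable {E : Type*} [NormedAddCommGroup E] [NormedSpace ℝ E] {g : E → ℝ}

theorem fderiv_smul_of_homogeneous
    (hhom : ∀ t : ℝ, 0 < t → ∀ x : E, x ≠ 0 → g (t • x) = g x) {r : ℝ} (hr : 0 < r) {x : E}
    (hx : x ≠ 0) : fderiv ℝ g (r • x) = r⁻¹ • fderiv ℝ g x := by
  have h : (fun y ↦ g (r • y)) =ᶠ[nhds x] g := by
    filter_upwards [isOpen_ne.mem_nhds hx] with y hy using hhom r hr y hy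
  rw [← h.fderiv_eq, fderiv_comp_smul, smul_smul, inv_mul_cancel₀ hr.ne', one_smul]

theorem fderiv_self_eq_zero_of_homogeneous
    (hhom : ∀ t : ℝ, 0 < t → ∀ x : E, x ≠ 0 → g (t • x) = g x) {x : E} (hx : x ≠ 0)
    (hg : DifferentiableAt ℝ g x) : fderiv ℝ g x x = 0 := by
  have h1 : HasDerivAt (fun t : ℝ ↦ g (t • x)) (fderiv ℝ g x x) 1 := by
    have h2 : HasDerivAt (fun t : ℝ ↦ t • x) x 1 := by
      simpa using (hasDerivAt_id (1 : ℝ)).smul_const x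
    have h3 : HasFDerivAt g (fderiv ℝ g x) ((1 : ℝ) • x) := by simpa using hg.hasFDerivAt
    exact h3.comp_hasDerivAt 1 h2
  have h4 : (fun t : ℝ ↦ g (t • x)) =ᶠ[nhds 1] fun _ ↦ g x := by
    filter_upwards [lt_mem_nhds one_pos] with t ht using hhom t ht x hx
  exact h1.unique ((hasDerivAt_const _ _).congr_of_eventuallyEq h4)

end Homogeneous

/-- A smooth cutoff `ψ`, to be used as the radial profile `x ↦ ψ (‖x‖ ^ 2)`. -/
theorem exists_radial_profile : ∃ ψ : ℝ → ℝ, ContDiff ℝ 1 ψ ∧ (∀ t, 0 ≤ ψ t) ∧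
    (∀ t, ψ t ≠ 0 ↔ t ∈ Ioo (1 : ℝ) 3) := by
  let b : ContDiffBump (2 : ℝ) := ⟨1 / 2, 1, by norm_num, by norm_num⟩
  refine ⟨b, b.contDiff, fun t ↦ b.nonneg, fun t ↦ ?_⟩
  have h := congrArg (fun s ↦ t ∈ s) b.support_eq
  simp only [mem_support, eq_iff_iff] at h
  rw [h, Real.ball_eq_Ioo]
  norm_num [b]

theorem integral_Ioi_radial_profile {ψ : ℝ → ℝ} (hψ : ContDiff ℝ 1 ψ)
    (hs : ∀ t, ψ t ≠ 0 ↔ t ∈ Ioo (1 : ℝ) 3) {n : ℕ} (hn : n ≠ 0) :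
    ∫ r in Ioi (0 : ℝ), r ^ n * (2 * r * deriv ψ (r ^ 2)) =
      -(n * ∫ r in Ioi (0 : ℝ), r ^ n * (ψ (r ^ 2) * r⁻¹)) := by
  have hψd : Differentiable ℝ ψ := hψ.differentiable one_ne_zero
  have hcs : HasCompactSupport fun r : ℝ ↦ ψ (r ^ 2) := by
    refine HasCompactSupport.intro (isCompact_Icc (a := (-2 : ℝ)) (b := 2)) fun r hr ↦ ?_
    by_contra h
    have := (hs _).1 h
    exact hr ⟨by nlinarith [this.1, this.2], by nlinarith [this.1, this.2]⟩
  have hder (r : ℝ) : HasDerivAt (fun r : ℝ ↦ ψ (r ^ 2) * r ^ n)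
      (r ^ n * (2 * r * deriv ψ (r ^ 2)) + n * (ψ (r ^ 2) * r ^ (n - 1))) r := by
    have h1 : HasDerivAt (fun r : ℝ ↦ r ^ 2) (2 * r) r := by simpa using hasDerivAt_pow 2 r
    have h2 := ((hψd (r ^ 2)).hasDerivAt.comp r h1).mul (hasDerivAt_pow n r)
    refine h2.congr_deriv ?_
    simp only [comp_apply]
    ring
  have hcψ : Continuous fun r : ℝ ↦ ψ (r ^ 2) := hψ.continuous.comp (continuous_pow 2)
  have hsq : ContDiff ℝ 1 fun r : ℝ ↦ ψ (r ^ 2) * r ^ n :=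
    (hψ.comp (contDiff_id.pow 2)).mul (contDiff_id.pow n)
  have hcs' : HasCompactSupport fun r : ℝ ↦ ψ (r ^ 2) * r ^ n := hcs.mul_right
  have key := hcs'.integral_Ioi_deriv_eq hsq 0
  rw [zero_pow hn, mul_zero, neg_zero] at key
  have hi2 : Integrable fun r : ℝ ↦ n * (ψ (r ^ 2) * r ^ (n - 1)) :=
    (Continuous.integrable_of_hasCompactSupport (by fun_prop) hcs.mul_right).const_mul _
  have hi : Integrable (deriv fun r : ℝ ↦ ψ (r ^ 2) * r ^ n) :=
    (hsq.continuous_deriv le_rfl).integrable_of_hasCompactSupport hcs'.deriv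
  have hi1 : Integrable fun r : ℝ ↦ r ^ n * (2 * r * deriv ψ (r ^ 2)) := by
    refine (hi.sub hi2).congr (.of_forall fun r ↦ ?_)
    simp [(hder r).deriv]
  have h3 : ∫ r in Ioi (0 : ℝ), r ^ n * (ψ (r ^ 2) * r⁻¹) =
      ∫ r in Ioi (0 : ℝ), ψ (r ^ 2) * r ^ (n - 1) := by
    refine setIntegral_congr_fun measurableSet_Ioi fun r hr ↦ ?_
    obtain ⟨m, rfl⟩ := Nat.exists_eq_succ_of_ne_zero hn
    have : r ≠ 0 := (mem_Ioi.1 hr).ne'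
    simp only [Nat.succ_eq_add_one, add_tsub_cancel_right]
    rw [pow_succ]
    field_simp
  rw [h3, ← integral_const_mul, eq_neg_iff_add_eq_zero,
    ← integral_add hi1.integrableOn hi2.integrableOn]
  refine Eq.trans ?_ key
  exact integral_congr_ae (.of_forall fun r ↦ (hder r).deriv.symm)

theorem integral_Ioi_radial_profile_pos {ψ : ℝ → ℝ} (hψ : ContDiff ℝ 1 ψ) (h0 : ∀ t, 0 ≤ ψ t)
    (hs : ∀ t, ψ t ≠ 0 ↔ t ∈ Ioo (1 : ℝ) 3) (n : ℕ) :
    0 < ∫ r in Ioi (0 : ℝ), r ^ n * (ψ (r ^ 2) * r⁻¹) := by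
  have hsupp : support (fun r : ℝ ↦ r ^ n * (ψ (r ^ 2) * r⁻¹)) ∩ Ioi 0 ⊆ Icc 1 2 := by
    rintro r ⟨hr, hr0 : 0 < r⟩
    have := (hs (r ^ 2)).1 fun h ↦ by simp [h] at hr
    exact ⟨by nlinarith [this.1, this.2], by nlinarith [this.1, this.2]⟩
  have hsupp' : Ioo (1 : ℝ) (3 / 2) ⊆
      support (fun r : ℝ ↦ r ^ n * (ψ (r ^ 2) * r⁻¹)) ∩ Ioi 0 := by
    rintro r ⟨hr1, hr2⟩
    have hr0 : 0 < r := by linarith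
    have := (hs (r ^ 2)).2 ⟨by nlinarith, by nlinarith⟩
    exact ⟨by simp [this, hr0.ne'], hr0⟩
  rw [setIntegral_pos_iff_support_of_nonneg_ae]
  · refine lt_of_lt_of_le ?_ (measure_mono hsupp')
    simp
    norm_num
  · filter_upwards [ae_restrict_mem measurableSet_Ioi] with r hr
    have : (0 : ℝ) < r := hr
    have := h0 (r ^ 2)
    simp only [Pi.zero_apply]
    positivity
  · have hc : ContinuousOn (fun r : ℝ ↦ r ^ n * (ψ (r ^ 2) * r⁻¹)) (Icc 1 2) := by
      have := hψ.continuous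
      refine ContinuousOn.mul (by fun_prop) (ContinuousOn.mul (by fun_prop)
        (continuousOn_inv₀.mono fun r hr ↦ ?_))
      have := hr.1
      simp only [mem_compl_iff, mem_singleton_iff]
      linarith
    refine (hc.integrableOn_compact isCompact_Icc).of_forall_sdiff_eq_zero measurableSet_Ioi ?_
    rintro r ⟨hr, hr'⟩
    by_contra h
    exact hr' (hsupp ⟨h, hr⟩)

section Divergence

variable {E : Type*} [NormedAddCommGroup E] [InnerProductSpace ℝ E] [FiniteDimensional ℝ E]
  [MeasurableSpace E] [BorelSpace E]

/-- The divergence theorem on the unit sphere, for the tangential part of the constant vector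
field `e`. -/
theorem integral_fderiv_toSphere_of_homogeneous (hd : 2 ≤ Module.finrank ℝ E) {g : E → ℝ}
    (hg : ContDiffOn ℝ 1 g {x | x ≠ 0})
    (hhom : ∀ t : ℝ, 0 < t → ∀ x : E, x ≠ 0 → g (t • x) = g x) (e : E) (μ : Measure E)
    [μ.IsAddHaarMeasure] :
    ∫ x : sphere (0 : E) 1, fderiv ℝ g x e ∂μ.toSphere =
      (Module.finrank ℝ E - 1) * ∫ x : sphere (0 : E) 1, g x * ⟪(x : E), e⟫ ∂μ.toSphere := by
  have : Nontrivial E := Module.nontrivial_of_finrank_pos (R := ℝ) (by lia)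
  obtain ⟨ψ, hψ, hψ0, hs⟩ := exists_radial_profile
  have hopen : IsOpen {x : E | x ≠ 0} := isOpen_ne
  set v : E → ℝ := fun x ↦ ψ (‖x‖ ^ 2) with hv
  have hv1 : ContDiff ℝ 1 v := hψ.comp (contDiff_norm_sq ℝ)
  have hvd (x : E) : fderiv ℝ v x e = 2 * deriv ψ (‖x‖ ^ 2) * ⟪x, e⟫ := by
    have h1 := ((hψ.differentiable one_ne_zero (‖x‖ ^ 2)).hasDerivAt.comp_hasFDerivAt x
      (hasStrictFDerivAt_norm_sq x).hasFDerivAt)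
    have h2 : fderiv ℝ v x = _ := h1.fderiv
    rw [h2]
    simp
    ring
  have hvc : HasCompactSupport v := by
    refine HasCompactSupport.intro (isCompact_closedBall (0 : E) 2) fun x hx ↦ ?_
    by_contra h
    have := (hs _).1 h
    refine hx (mem_closedBall_zero_iff.2 ?_)
    nlinarith [this.1, this.2]
  have hvs : tsupport v ⊆ {x : E | x ≠ 0} := by
    have h1 : tsupport v ⊆ {x : E | 1 ≤ ‖x‖ ^ 2} :=
      closure_minimal (fun x hx ↦ ((hs _).1 hx).1.le)
        (isClosed_le continuous_const (by fun_prop))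
    intro x hx h
    have := h1 hx
    norm_num [h] at this
  have hg' : ContinuousOn (fun x ↦ fderiv ℝ g x e) {x | x ≠ 0} :=
    (hg.continuousOn_fderiv_of_isOpen hopen le_rfl).clm_apply continuousOn_const
  have hv'c : Continuous fun x ↦ fderiv ℝ v x e :=
    (hv1.continuous_fderiv one_ne_zero).clm_apply continuous_const
  have hparts := integral_mul_fderiv_eq_neg_fderiv_mul_of_integrable (μ := μ) (f := g) (g := v)
    (v := e) (integrable_mul_of_tsupport_subset hg' hv1.continuous hvc hvs)
    (integrable_mul_of_tsupport_subset hg.continuousOn hv'c (hvc.fderiv_apply ℝ e)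
      ((tsupport_fderiv_apply_subset ℝ e).trans hvs))
    (integrable_mul_of_tsupport_subset hg.continuousOn hv1.continuous hvc hvs)
    (fun x hx ↦ (hg.differentiableOn one_ne_zero).differentiableAt (hopen.mem_nhds (hvs hx)))
    (fun x _ ↦ hv1.differentiable one_ne_zero x)
  have hne (θ : sphere (0 : E) 1) : (θ : E) ≠ 0 := ne_zero_of_mem_unit_sphere θ
  have hnorm (θ : sphere (0 : E) 1) {r : ℝ} (hr : 0 < r) : ‖r • (θ : E)‖ = r := by
    simp [norm_smul, hr.le]
  rw [integral_eq_integral_toSphere_mul_integral_Ioi μ (fun θ ↦ g θ * ⟪(θ : E), e⟫)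
      (fun r ↦ 2 * r * deriv ψ (r ^ 2)) fun θ r hr ↦ by
        rw [hvd, hnorm θ hr, hhom r hr _ (hne θ), real_inner_smul_left]; ring,
    integral_eq_integral_toSphere_mul_integral_Ioi μ (fun θ ↦ fderiv ℝ g θ e)
      (fun r ↦ ψ (r ^ 2) * r⁻¹) fun θ r hr ↦ by
        simp only [hv]
        rw [hnorm θ hr, fderiv_smul_of_homogeneous hhom hr (hne θ), smul_apply,
          smul_eq_mul]
        ring,
    integral_Ioi_radial_profile hψ hs (by lia), Nat.cast_sub (by lia), Nat.cast_one] at hparts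
  have hpos := integral_Ioi_radial_profile_pos hψ hψ0 hs (Module.finrank ℝ E - 1)
  refine mul_right_cancel₀ hpos.ne' ?_
  linarith

end Divergence

/-- **Corollary 4.6.** If `f` is `C¹` away from the origin, positively homogeneous of
degree `0`, with `(1/ω_d) ∫_{S^{d-1}} f² dσ = 1`, then
`(1 - ‖τ(f)‖²)((1/ω_d)∫ ‖∇f‖² dσ) ≥ ((d-1)/2)² ‖τ(f)‖²`. -/
theorem uncertainty_principle_tau (d : ℕ) (hd : 2 ≤ d)
    (f : EuclideanSpace ℝ (Fin d) → ℝ)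
    (hf : ContDiffOn ℝ 1 f {x : EuclideanSpace ℝ (Fin d) | x ≠ 0})
    (hhom : ∀ t : ℝ, 0 < t → ∀ x : EuclideanSpace ℝ (Fin d), x ≠ 0 → f (t • x) = f x)
    (hnorm : (1 / omegaSphere d) * ∫ x : Metric.sphere (0 : EuclideanSpace ℝ (Fin d)) 1,
        f (x : EuclideanSpace ℝ (Fin d)) ^ 2 ∂(sphereMeasure d) = 1) :
    (1 - ‖tauVec d f‖ ^ 2) *
      ((1 / omegaSphere d) * ∫ x : Metric.sphere (0 : EuclideanSpace ℝ (Fin d)) 1,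
        ‖gradient f (x : EuclideanSpace ℝ (Fin d))‖ ^ 2 ∂(sphereMeasure d)) ≥
      (((d : ℝ) - 1) / 2) ^ 2 * ‖tauVec d f‖ ^ 2 := by
  have hω : 0 < 1 / omegaSphere d := by
    have : 0 < (d : ℝ) / 2 := by positivity
    have := Real.Gamma_pos_of_pos this
    unfold omegaSphere
    positivity
  have hτ : tauVec d f = (1 / omegaSphere d) • ∫ x : sphere (0 : EuclideanSpace ℝ (Fin d)) 1,
    f (x : EuclideanSpace ℝ (Fin d)) ^ 2 • (x : EuclideanSpace ℝ (Fin d)) ∂(sphereMeasure d) := rfl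
  set τ := tauVec d f
  set c := 1 / omegaSphere d
  have : IsFiniteMeasure (sphereMeasure d) := by unfold sphereMeasure; infer_instance
  have hopen : IsOpen {x : EuclideanSpace ℝ (Fin d) | x ≠ 0} := isOpen_ne
  have hne (x : sphere (0 : EuclideanSpace ℝ (Fin d)) 1) : (x : EuclideanSpace ℝ (Fin d)) ≠ 0 :=
    ne_zero_of_mem_unit_sphere x
  have hdiff (x : sphere (0 : EuclideanSpace ℝ (Fin d)) 1) : DifferentiableAt ℝ f x :=
    (hf.differentiableOn one_ne_zero).differentiableAt (hopen.mem_nhds (hne x))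
  have hfc : Continuous fun x : sphere (0 : EuclideanSpace ℝ (Fin d)) 1 ↦ f x :=
    hf.continuousOn.comp_continuous continuous_subtype_val hne
  have hgc : Continuous fun x : sphere (0 : EuclideanSpace ℝ (Fin d)) 1 ↦ gradient f x :=
    (InnerProductSpace.toDual ℝ _).symm.continuous.comp
      ((hf.continuousOn_fderiv_of_isOpen hopen le_rfl).comp_continuous continuous_subtype_val hne)
  have hcint {h : sphere (0 : EuclideanSpace ℝ (Fin d)) 1 → ℝ} (hh : Continuous h) :
      Integrable h (sphereMeasure d) :=
    hh.integrable_of_hasCompactSupport (HasCompactSupport.of_compactSpace h)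
  have hgrad (x y : EuclideanSpace ℝ (Fin d)) : ⟪gradient f x, y⟫ = fderiv ℝ f x y :=
    InnerProductSpace.toDual_symm_apply
  obtain ⟨φ, hφ⟩ : ∃ φ : sphere (0 : EuclideanSpace ℝ (Fin d)) 1 → ℝ, ∀ x, φ x = f x :=
    ⟨_, fun _ ↦ rfl⟩
  obtain ⟨γ, hγ⟩ : ∃ γ : sphere (0 : EuclideanSpace ℝ (Fin d)) 1 → EuclideanSpace ℝ (Fin d),
      ∀ x, γ x = gradient f x := ⟨_, fun _ ↦ rfl⟩
  simp only [← hφ, ← hγ] at hnorm hτ hfc hgc ⊢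
  have hN : c * ∫ x : sphere (0 : EuclideanSpace ℝ (Fin d)) 1,
      φ x ^ 2 * ⟪(x : EuclideanSpace ℝ (Fin d)), τ⟫ ∂(sphereMeasure d) = ‖τ‖ ^ 2 := by
    rw [← real_inner_self_eq_norm_sq]
    conv_rhs => enter [3]; rw [hτ]
    rw [real_inner_smul_right, ← integral_inner]
    · simp only [real_inner_smul_right, real_inner_comm]
    · exact Continuous.integrable_of_hasCompactSupport (by fun_prop)
        (HasCompactSupport.of_compactSpace _)
  have hibp : c * ∫ x : sphere (0 : EuclideanSpace ℝ (Fin d)) 1,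
      φ x * ⟪γ x, τ⟫ ∂(sphereMeasure d) = (d - 1) / 2 * ‖τ‖ ^ 2 := by
    have h := integral_fderiv_toSphere_of_homogeneous (g := fun x ↦ f x ^ 2) (by simpa using hd)
      (hf.pow 2) (fun t ht x hx ↦ by simp only [hhom t ht x hx]) τ volume
    have h2 (x : sphere (0 : EuclideanSpace ℝ (Fin d)) 1) :
        fderiv ℝ (fun x ↦ f x ^ 2) x τ = 2 * (φ x * ⟪γ x, τ⟫) := by
      rw [fderiv_fun_pow 2 (hdiff x), hφ, hγ, hgrad]
      simp
      ring
    simp only [h2, finrank_euclideanSpace_fin, ← hφ] at h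
    rw [integral_const_mul] at h
    rw [← hN]
    unfold sphereMeasure
    linear_combination c / 2 * h
  set G := c * ∫ x : sphere (0 : EuclideanSpace ℝ (Fin d)) 1,
    ‖γ x‖ ^ 2 ∂(sphereMeasure d)
  set P := c * ∫ x : sphere (0 : EuclideanSpace ℝ (Fin d)) 1,
    φ x ^ 2 * ⟪(x : EuclideanSpace ℝ (Fin d)), τ⟫ ^ 2 ∂(sphereMeasure d)
  have hP2 : (‖τ‖ ^ 2) ^ 2 ≤ P := by
    have h : 0 ≤ c * ∫ x : sphere (0 : EuclideanSpace ℝ (Fin d)) 1,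
        (φ x * (⟪(x : EuclideanSpace ℝ (Fin d)), τ⟫ - ‖τ‖ ^ 2)) ^ 2 ∂(sphereMeasure d) :=
      mul_nonneg hω.le (integral_nonneg fun x ↦ sq_nonneg _)
    have he (x : sphere (0 : EuclideanSpace ℝ (Fin d)) 1) :
        (φ x * (⟪(x : EuclideanSpace ℝ (Fin d)), τ⟫ - ‖τ‖ ^ 2)) ^ 2 =
          φ x ^ 2 * ⟪(x : EuclideanSpace ℝ (Fin d)), τ⟫ ^ 2
          - 2 * ‖τ‖ ^ 2 * (φ x ^ 2 * ⟪(x : EuclideanSpace ℝ (Fin d)), τ⟫)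
          + (‖τ‖ ^ 2) ^ 2 * φ x ^ 2 := by ring
    simp only [he] at h
    rw [integral_add (hcint (by fun_prop)) (hcint (by fun_prop)),
      integral_sub (hcint (by fun_prop)) (hcint (by fun_prop)), integral_const_mul,
      integral_const_mul] at h
    linear_combination h + (‖τ‖ ^ 2) ^ 2 * hnorm - 2 * ‖τ‖ ^ 2 * hN
  have hquad (s : ℝ) : 0 ≤ (‖τ‖ ^ 2 - P) * (s * s) + (-((d - 1) * ‖τ‖ ^ 2)) * s + G := by
    have h : 0 ≤ c * ∫ x : sphere (0 : EuclideanSpace ℝ (Fin d)) 1,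
        ‖γ x - (s * φ x) • (τ - ⟪(x : EuclideanSpace ℝ (Fin d)), τ⟫ •
          (x : EuclideanSpace ℝ (Fin d)))‖ ^ 2 ∂(sphereMeasure d) :=
      mul_nonneg hω.le (integral_nonneg fun x ↦ sq_nonneg _)
    have he (x : sphere (0 : EuclideanSpace ℝ (Fin d)) 1) :
        ‖γ x - (s * φ x) • (τ - ⟪(x : EuclideanSpace ℝ (Fin d)), τ⟫ •
          (x : EuclideanSpace ℝ (Fin d)))‖ ^ 2 =
        ‖γ x‖ ^ 2 - 2 * s * (φ x * ⟪γ x, τ⟫)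
          + s ^ 2 * (‖τ‖ ^ 2 * φ x ^ 2 - φ x ^ 2 * ⟪(x : EuclideanSpace ℝ (Fin d)), τ⟫ ^ 2) := by
      have h0 : ⟪γ x, (x : EuclideanSpace ℝ (Fin d))⟫ = 0 := by
        rw [hγ, hgrad]; exact fderiv_self_eq_zero_of_homogeneous hhom (hne x) (hdiff x)
      have h1 : ‖(x : EuclideanSpace ℝ (Fin d))‖ = 1 := norm_eq_of_mem_sphere x
      have h2 : ‖τ - ⟪(x : EuclideanSpace ℝ (Fin d)), τ⟫ • (x : EuclideanSpace ℝ (Fin d))‖ ^ 2 =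
          ‖τ‖ ^ 2 - ⟪(x : EuclideanSpace ℝ (Fin d)), τ⟫ ^ 2 := by
        rw [norm_sub_sq_real, real_inner_smul_right, norm_smul, h1,
          real_inner_comm (x : EuclideanSpace ℝ (Fin d)) τ, mul_one, Real.norm_eq_abs, sq_abs]
        ring
      rw [norm_sub_sq_real, real_inner_smul_right, inner_sub_right, real_inner_smul_right, h0,
        norm_smul, mul_pow, h2, Real.norm_eq_abs, sq_abs]
      ring
    simp only [he] at h
    rw [integral_add (hcint (by fun_prop)) (hcint (by fun_prop)),
      integral_sub (hcint (by fun_prop)) (hcint (by fun_prop)), integral_const_mul,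
      integral_const_mul, integral_sub (hcint (by fun_prop)) (hcint (by fun_prop)),
      integral_const_mul] at h
    linear_combination h - 2 * s * hibp + s ^ 2 * ‖τ‖ ^ 2 * hnorm
  have hG0 : 0 ≤ G := mul_nonneg hω.le (integral_nonneg fun x ↦ sq_nonneg _)
  have hdisc := discrim_le_zero hquad
  unfold discrim at hdisc
  rcases (sq_nonneg ‖τ‖).eq_or_lt with h0 | h0
  · simpa [← h0] using hG0
  · refine le_of_mul_le_mul_right ?_ h0
    nlinarith [mul_le_mul_of_nonneg_right hP2 hG0]
end
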